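/- arXiv:2601.15022 — 8 statements merged into one kernel-verified Lean document; each statement's English description precedes it below -/
import Mathlib

section
/- Consider the singular initial value problem y'(t) = (1/t)·M₋₁(y(t)) + M(t, y(t)) with y(0) = y₀, where y takes values in ℝ^k, M₋₁ : ℝ^k → ℝ^k is smooth (C^∞) in a neighborhood of y₀, and M : ℝ × ℝ^k → ℝ^k is smooth in a neighborhood of (0, y₀). Assume (i) M₋₁(y₀) = 0 and (ii) for every positive integer h the linear map h·Id − D_{y₀}M₋₁ (with D_{y₀}M₋₁ the Fréchet derivative of M₋₁ at y₀) is invertible. Then there exist ε > 0 and a smooth function y : [0, ε) → ℝ^k with y(0) = y₀ satisfying y'(t) = (1/t)·M₋₁(y(t)) + M(t, y(t)) for all t ∈ (0, ε); moreover y is unique in the sense that any two smooth solutions of this initial value problem agree on a neighborhood of 0. -/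
open Set Filter

/-- A solution of the singular initial value problem
`y'(t) = (1/t)·M₋₁(y(t)) + M(t, y(t))`, `y(0) = y₀`, on `[0, ε)`. -/
def IsSingularIVPSolution {k : ℕ} (Mneg : (Fin k → ℝ) → (Fin k → ℝ))
    (M : ℝ × (Fin k → ℝ) → (Fin k → ℝ)) (y₀ : Fin k → ℝ) (ε : ℝ)
    (y : ℝ → (Fin k → ℝ)) : Prop :=
  ContDiffOn ℝ (⊤ : ℕ∞) y (Set.Ico 0 ε) ∧ y 0 = y₀ ∧
    ∀ t ∈ Set.Ioo 0 ε, HasDerivAt y ((1 / t) • Mneg (y t) + M (t, y t)) t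

open scoped ContDiff Topology

lemma aux_contDiff_param {X : Type} [NormedAddCommGroup X] [NormedSpace ℝ X]
    [FiniteDimensional ℝ X] (n : ℕ) :
    ∀ {F : Type} [NormedAddCommGroup F] [NormedSpace ℝ F] [CompleteSpace F]
      (f : X × ℝ → F), ContDiff ℝ ∞ f →
      ContDiff ℝ n (fun x => ∫ s in (0:ℝ)..1, f (x, s)) := by
  induction n with
  | zero =>
    intro F _ _ _ f hf
    have := hf.continuous
    simp only [Nat.cast_zero, contDiff_zero]
    apply intervalIntegral.continuous_parametric_intervalIntegral_of_continuous'
    exact this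
  | succ n ih =>
    intro F _ _ _ f hf
    have hf1 : ContDiff ℝ ∞ (fun p : X × ℝ => (fderiv ℝ f p).comp (ContinuousLinearMap.inl ℝ X ℝ)) := by
      have h1 : ContDiff ℝ ∞ (fderiv ℝ f) := hf.fderiv_right (by simp)
      exact h1.clm_comp contDiff_const
    have hproper : ProperSpace X := FiniteDimensional.proper ℝ X
    rw [Nat.cast_add, Nat.cast_one, contDiff_succ_iff_hasFDerivAt]
    refine ⟨fun x => ∫ s in (0:ℝ)..1, (fderiv ℝ f (x, s)).comp (ContinuousLinearMap.inl ℝ X ℝ),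
      ih _ hf1, ?_⟩
    intro x₀
    have hK : IsCompact (Metric.closedBall x₀ 1 ×ˢ Icc (0:ℝ) 1) :=
      (isCompact_closedBall x₀ 1).prod isCompact_Icc
    obtain ⟨C, hC⟩ := hK.exists_bound_of_continuousOn hf1.continuous.continuousOn
    have hcf : Continuous f := hf.continuous
    refine (intervalIntegral.hasFDerivAt_integral_of_dominated_of_fderiv_le
      (F := fun x s => f (x, s))
      (F' := fun x s => (fderiv ℝ f (x, s)).comp (ContinuousLinearMap.inl ℝ X ℝ))
      (bound := fun _ => C) (s := Metric.ball x₀ 1) (Metric.ball_mem_nhds x₀ one_pos)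
      ?_ ?_ ?_ ?_ ?_ ?_)
    · filter_upwards with x
      exact (by fun_prop : Continuous fun s => f (x, s)).aestronglyMeasurable
    · exact (by fun_prop : Continuous fun s => f (x₀, s)).intervalIntegrable _ _
    · exact (hf1.continuous.comp (by fun_prop : Continuous fun s : ℝ => (x₀, s))).aestronglyMeasurable
    · filter_upwards with t ht x hx
      apply hC (x, t)
      rw [uIoc_of_le zero_le_one] at ht
      exact ⟨Metric.ball_subset_closedBall hx, ht.1.le, ht.2⟩
    · simp
    · filter_upwards with t ht x hx
      have h2 : HasFDerivAt f (fderiv ℝ f (x, t)) (x, t) :=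
        (hf.differentiable (by simp) (x, t)).hasFDerivAt
      exact h2.comp x (hasFDerivAt_prodMk_left x t)

lemma aux_hadamard {E : Type} [NormedAddCommGroup E] [NormedSpace ℝ E]
    [FiniteDimensional ℝ E] (g : ℝ × E → E) (hg : ContDiff ℝ ∞ g) :
    ∃ q : ℝ × E → E, ContDiff ℝ ∞ q ∧ (∀ t z, g (t, z) = g (0, z) + t • q (t, z)) ∧
      ∀ z, q (0, z) = fderiv ℝ g (0, z) (1, 0) := by
  have hcomp : CompleteSpace E := FiniteDimensional.complete ℝ E
  have h1 : ContDiff ℝ ∞ (fderiv ℝ g) := hg.fderiv_right (by simp)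
  let f : (ℝ × E) × ℝ → E := fun p => fderiv ℝ g (p.2 * p.1.1, p.1.2) (1, 0)
  have hf : ContDiff ℝ ∞ f := by
    apply ContDiff.clm_apply _ contDiff_const
    exact h1.comp (by fun_prop)
  refine ⟨fun p => ∫ s in (0:ℝ)..1, f (p, s), ?_, ?_, ?_⟩
  · rw [contDiff_infty]
    intro n
    exact aux_contDiff_param n f hf
  · intro t z
    have hd : ∀ s ∈ uIcc (0:ℝ) 1, HasDerivAt (fun s => g (s * t, z)) (t • f ((t, z), s)) s := by
      intro s _
      have h2 : HasFDerivAt g (fderiv ℝ g (s * t, z)) (s * t, z) :=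
        (hg.differentiable (by simp) _).hasFDerivAt
      have h3 : HasDerivAt (fun s : ℝ => (s * t, z)) (t, (0:E)) s := by
        apply HasDerivAt.prodMk
        · simpa using (hasDerivAt_id s).mul_const t
        · exact hasDerivAt_const _ _
      have h4 := h2.comp_hasDerivAt s h3
      convert! h4 using 1
      simp only [f]
      rw [← map_smul]
      simp
    have hi := intervalIntegral.integral_eq_sub_of_hasDerivAt hd (by
      have := hf.continuous
      exact (by fun_prop : Continuous fun s => t • f ((t, z), s)).intervalIntegrable _ _)
    rw [intervalIntegral.integral_smul] at hi
    rw [hi]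
    simp
  · intro z
    simp [f]

/-- Data of a Briot-Bouquet type system `t x' = G (t, x)` with linear part `B`. -/
structure AuxBB {E : Type} [NormedAddCommGroup E] [NormedSpace ℝ E]
    (G : ℝ × E → E) (B : E →L[ℝ] E) : Prop where
  smooth : ContDiff ℝ ∞ G
  zero : G (0, 0) = 0
  lin : ∀ v, fderiv ℝ G (0, 0) (0, v) = B v

/-- Continuous solutions of `t x' = G (t, x)` on `[0, δ)` with `x 0 = 0`. -/
structure AuxSol {E : Type} [NormedAddCommGroup E] [NormedSpace ℝ E]
    (G : ℝ × E → E) (δ : ℝ) (x : ℝ → E) : Prop where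
  pos : 0 < δ
  cont : ContinuousOn x (Ico 0 δ)
  zero : x 0 = 0
  deriv : ∀ t ∈ Ioo 0 δ, HasDerivAt x (t⁻¹ • G (t, x t)) t

section
variable {E : Type} [NormedAddCommGroup E] [NormedSpace ℝ E]

lemma AuxSol.mono {G : ℝ × E → E} {δ δ' : ℝ} {x : ℝ → E} (h : AuxSol G δ x)
    (h0 : 0 < δ') (hle : δ' ≤ δ) : AuxSol G δ' x :=
  ⟨h0, h.cont.mono (Ico_subset_Ico_right hle), h.zero,
    fun t ht => h.deriv t ⟨ht.1, ht.2.trans_le hle⟩⟩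

lemma AuxSol.small {G : ℝ × E → E} {δ : ℝ} {x : ℝ → E} (h : AuxSol G δ x) {r : ℝ} (hr : 0 < r) :
    ∃ δ' > 0, δ' ≤ δ ∧ δ' ≤ r ∧ ∀ t ∈ Ico 0 δ', ‖x t‖ ≤ r := by
  have h1 : ContinuousWithinAt x (Ico 0 δ) 0 := h.cont 0 ⟨le_rfl, h.pos⟩
  rw [Metric.continuousWithinAt_iff] at h1
  obtain ⟨η, hη, h2⟩ := h1 r hr
  refine ⟨min η (min δ r), lt_min hη (lt_min h.pos hr), (min_le_right _ _).trans (min_le_left _ _),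
    (min_le_right _ _).trans (min_le_right _ _), ?_⟩
  intro t ht
  have h3 := ht.2
  simp only [lt_min_iff] at h3
  have h4 := h2 (x := t) ⟨ht.1, h3.2.1⟩ (by simpa [abs_of_nonneg ht.1] using h3.1)
  rw [h.zero, dist_zero_right] at h4
  exact h4.le

lemma AuxBB.lip {G : ℝ × E → E} {B : E →L[ℝ] E} (h : AuxBB G B) {c : ℝ} (hc : 0 < c) :
    ∃ r > 0, ∀ t x y, |t| ≤ r → ‖x‖ ≤ r → ‖y‖ ≤ r →
      ‖G (t, x) - G (t, y) - B (x - y)‖ ≤ c * ‖x - y‖ := by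
  have h1 : HasStrictFDerivAt G (fderiv ℝ G (0, 0)) (0, 0) :=
    h.smooth.hasStrictFDerivAt (by simp)
  have h2 := h1.isLittleO.def hc
  rw [Metric.eventually_nhds_iff] at h2
  obtain ⟨ρ, hρ, h3⟩ := h2
  refine ⟨ρ / 2, by positivity, ?_⟩
  intro t x y ht hx hy
  have h4 := @h3 ((t, x), (t, y)) (by
    simp only [Prod.dist_eq, dist_zero_right, Real.norm_eq_abs]
    simp only [sup_lt_iff]
    refine ⟨⟨?_, ?_⟩, ?_, ?_⟩ <;> linarith)
  have h5 : ((t, x) - (t, y) : ℝ × E) = (0, x - y) := by simp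
  simp only [h5, h.lin] at h4
  simpa [Prod.norm_def] using h4

lemma AuxBB.lipN {G : ℝ × E → E} {B : E →L[ℝ] E} (h : AuxBB G B) (N : ℝ) {K : ℝ}
    (hK : ‖N • ContinuousLinearMap.id ℝ E + B‖ < K) :
    ∃ r > 0, ∀ t x y, |t| ≤ r → ‖x‖ ≤ r → ‖y‖ ≤ r →
      ‖N • (x - y) + (G (t, x) - G (t, y))‖ ≤ K * ‖x - y‖ := by
  obtain ⟨r, hr, h1⟩ := h.lip (sub_pos.2 hK)
  refine ⟨r, hr, fun t x y ht hx hy => ?_⟩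
  have h2 := h1 t x y ht hx hy
  have h3 := (N • ContinuousLinearMap.id ℝ E + B).le_opNorm (x - y)
  have h4 : N • (x - y) + (G (t, x) - G (t, y)) = (G (t, x) - G (t, y) - B (x - y)) +
    (N • ContinuousLinearMap.id ℝ E + B) (x - y) := by
    simp only [add_apply, smul_apply,
      ContinuousLinearMap.id_apply]
    abel
  rw [h4]
  refine (norm_add_le _ _).trans ?_
  linarith

lemma aux_gronwall {v v' : ℝ → E} {δ L C : ℝ} {N : ℕ} (hL : L < N)
    (hd : ∀ t ∈ Ioo 0 δ, HasDerivAt v (v' t) t)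
    (hb : ∀ t ∈ Ioo 0 δ, ‖v' t‖ ≤ t⁻¹ * (L * ‖v t‖))
    (hC : ∀ t ∈ Ioo 0 δ, ‖v t‖ ≤ C * t ^ N) : ∀ t ∈ Ioo 0 δ, v t = 0 := by
  intro t ht
  have key : ∀ τ ∈ Ioo 0 t, ‖v t‖ ≤ ‖v τ‖ * Real.exp (L * (Real.log t - Real.log τ)) := by
    intro τ hτ
    have hmem : ∀ s ∈ Icc (Real.log τ) (Real.log t), Real.exp s ∈ Ioo 0 δ := by
      intro s hs
      refine ⟨Real.exp_pos s, lt_of_le_of_lt ?_ ht.2⟩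
      rw [← Real.exp_log ht.1]
      exact Real.exp_le_exp.2 hs.2
    have hder : ∀ s ∈ Icc (Real.log τ) (Real.log t),
        HasDerivAt (fun s => v (Real.exp s)) (Real.exp s • v' (Real.exp s)) s := by
      intro s hs
      exact (hd _ (hmem s hs)).scomp s (Real.hasDerivAt_exp s)
    have h := norm_le_gronwallBound_of_norm_deriv_right_le (f := fun s => v (Real.exp s))
      (f' := fun s => Real.exp s • v' (Real.exp s)) (δ := ‖v τ‖) (K := L) (ε := 0)
      (a := Real.log τ) (b := Real.log t)
      (fun s hs => (hder s hs).continuousAt.continuousWithinAt)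
      (fun s hs => (hder s (Ico_subset_Icc_self hs)).hasDerivWithinAt)
      (by simp [Real.exp_log hτ.1])
      (by
        intro s hs
        have h1 := hb _ (hmem s (Ico_subset_Icc_self hs))
        rw [norm_smul, Real.norm_eq_abs, abs_of_pos (Real.exp_pos s), add_zero]
        calc Real.exp s * ‖v' (Real.exp s)‖
            ≤ Real.exp s * ((Real.exp s)⁻¹ * (L * ‖v (Real.exp s)‖)) := by gcongr
          _ = _ := by
            rw [← mul_assoc, mul_inv_cancel₀ (Real.exp_pos s).ne', one_mul])
      (Real.log t) ⟨Real.log_le_log hτ.1 hτ.2.le, le_rfl⟩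
    rw [gronwallBound_ε0] at h
    simpa [Real.exp_log ht.1] using h
  have key2 : ∀ τ ∈ Ioo 0 t,
      ‖v t‖ ≤ C * Real.exp (L * Real.log t) * Real.exp ((N - L) * Real.log τ) := by
    intro τ hτ
    refine (key τ hτ).trans ?_
    have h1 := hC τ ⟨hτ.1, hτ.2.trans ht.2⟩
    have h2 : τ ^ N = Real.exp (N * Real.log τ) := by
      rw [Real.exp_nat_mul, Real.exp_log hτ.1]
    calc ‖v τ‖ * Real.exp (L * (Real.log t - Real.log τ))
        ≤ C * τ ^ N * Real.exp (L * (Real.log t - Real.log τ)) := by gcongr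
      _ = _ := by
        rw [h2, mul_assoc, mul_assoc, ← Real.exp_add, ← Real.exp_add]
        ring_nf
  have hlim : Tendsto (fun τ => C * Real.exp (L * Real.log t) * Real.exp ((N - L) * Real.log τ))
      (𝓝[>] 0) (𝓝 (C * Real.exp (L * Real.log t) * 0)) := by
    apply Tendsto.const_mul
    apply Real.tendsto_exp_atBot.comp
    exact Real.tendsto_log_nhdsGT_zero.const_mul_atBot (sub_pos.2 hL)
  rw [mul_zero] at hlim
  have : ‖v t‖ ≤ 0 := by
    apply ge_of_tendsto hlim
    filter_upwards [Ioo_mem_nhdsGT ht.1] with τ hτ using key2 τ hτ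
  exact norm_le_zero_iff.1 this

lemma AuxBB.unique {G : ℝ × E → E} {B : E →L[ℝ] E} (h : AuxBB G B) (N : ℕ)
    (hN : ‖(N : ℝ) • ContinuousLinearMap.id ℝ E + B‖ < N) {δ₁ δ₂ : ℝ} {x₁ x₂ : ℝ → E}
    (h₁ : AuxSol G δ₁ x₁) (h₂ : AuxSol G δ₂ x₂) :
    ∃ δ > 0, δ ≤ δ₁ ∧ δ ≤ δ₂ ∧ EqOn x₁ x₂ (Ico 0 δ) := by
  obtain ⟨K, hK1, hK2⟩ := exists_between hN
  obtain ⟨r, hr, hlip⟩ := h.lipN N hK1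
  obtain ⟨a, ha, ha1, ha2, ha3⟩ := h₁.small hr
  obtain ⟨b, hb, hb1, hb2, hb3⟩ := h₂.small hr
  have hNpos : 0 < N := by
    rcases Nat.eq_zero_or_pos N with h0 | h0
    · subst h0
      simp only [Nat.cast_zero] at hN
      exact absurd hN (not_lt.2 (norm_nonneg _))
    · exact h0
  refine ⟨min a b, lt_min ha hb, (min_le_left _ _).trans ha1, (min_le_right _ _).trans hb1, ?_⟩
  have hz := aux_gronwall (v := fun t => t ^ N • (x₁ t - x₂ t))
    (v' := fun t => (t ^ N * t⁻¹) • ((N : ℝ) • (x₁ t - x₂ t) + (G (t, x₁ t) - G (t, x₂ t))))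
    (δ := min a b) (C := 2 * r) hK2 ?_ ?_ ?_
  · intro t ht
    rcases eq_or_lt_of_le ht.1 with h0 | h0
    · rw [← h0, h₁.zero, h₂.zero]
    · have := hz t ⟨h0, ht.2⟩
      simp only [smul_eq_zero] at this
      rcases this with h3 | h3
      · exact absurd h3 (pow_pos h0 N).ne'
      · exact sub_eq_zero.1 h3
  · intro t ht
    have ht2 := ht.2
    rw [lt_min_iff] at ht2
    have d1 := h₁.deriv t ⟨ht.1, ht2.1.trans_le ha1⟩
    have d2 := h₂.deriv t ⟨ht.1, ht2.2.trans_le hb1⟩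
    have := (hasDerivAt_pow N t).smul (d1.sub d2)
    convert! this using 1
    have hpow : t ^ N * t⁻¹ = t ^ (N - 1) := by
      obtain ⟨m, rfl⟩ : ∃ m, N = m + 1 := ⟨N - 1, by omega⟩
      rw [pow_succ, mul_assoc, mul_inv_cancel₀ ht.1.ne']
      simp
    rw [smul_add, hpow, smul_smul, ← smul_sub, smul_smul, hpow, add_comm, mul_comm]
    rfl
  · intro t ht
    have ht2 := ht.2
    rw [lt_min_iff] at ht2
    have h3 := hlip t (x₁ t) (x₂ t) (by rw [abs_of_pos ht.1]; linarith)
      (ha3 t ⟨ht.1.le, ht2.1⟩) (hb3 t ⟨ht.1.le, ht2.2⟩)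
    have htp := pow_pos ht.1 N
    have hti := inv_pos.2 ht.1
    rw [norm_smul, norm_smul, norm_mul, norm_inv, norm_pow, Real.norm_eq_abs, abs_of_pos ht.1]
    calc t ^ N * t⁻¹ * _ ≤ t ^ N * t⁻¹ * (K * ‖x₁ t - x₂ t‖) := by gcongr
      _ = _ := by ring
  · intro t ht
    have ht2 := ht.2
    rw [lt_min_iff] at ht2
    have h5 := ha3 t ⟨ht.1.le, ht2.1⟩
    have h6 := hb3 t ⟨ht.1.le, ht2.2⟩
    have htp := pow_pos ht.1 N
    rw [norm_smul, norm_pow, Real.norm_eq_abs, abs_of_pos ht.1, mul_comm]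
    gcongr
    linarith [norm_sub_le (x₁ t) (x₂ t)]

lemma AuxBB.blowup [FiniteDimensional ℝ E] {G : ℝ × E → E} {B : E →L[ℝ] E} (h : AuxBB G B)
    (hu : IsUnit (((1 : ℕ) : ℝ) • ContinuousLinearMap.id ℝ E - B)) :
    ∃ (z₀ : E) (G₂ : ℝ × E → E), AuxBB G₂ (B - ContinuousLinearMap.id ℝ E) ∧
      ∀ t x, G (t, t • (z₀ + x)) = t • (z₀ + x + G₂ (t, x)) := by
  obtain ⟨z₀, hz⟩ : ∃ z₀, z₀ - B z₀ = fderiv ℝ G (0, 0) (1, 0) := by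
    obtain ⟨u, hu⟩ := hu
    refine ⟨(↑u⁻¹ : E →L[ℝ] E) (fderiv ℝ G (0, 0) (1, 0)), ?_⟩
    have h1 : (↑u * ↑u⁻¹ : E →L[ℝ] E) = 1 := u.mul_inv
    rw [hu] at h1
    have h2 := congrArg (fun T : E →L[ℝ] E => T (fderiv ℝ G (0, 0) (1, 0))) h1
    simpa using h2
  obtain ⟨q, hq, hq1, hq2⟩ := aux_hadamard (fun p : ℝ × E => G (p.1, p.1 • p.2))
    (h.smooth.comp (by fun_prop))
  have hq3 : ∀ z, q (0, z) = fderiv ℝ G (0, 0) (1, 0) + B z := by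
    intro z
    rw [hq2]
    have h1 : HasFDerivAt G (fderiv ℝ G (0, 0)) (0, (0 : ℝ) • z) := by
      rw [zero_smul]
      exact (h.smooth.differentiable (by simp) _).hasFDerivAt
    have h2 : HasDerivAt (fun t : ℝ => G (t, t • z)) (fderiv ℝ G (0, 0) (1, z)) 0 := by
      refine h1.comp_hasDerivAt (0:ℝ) ?_
      apply (hasDerivAt_id (0:ℝ)).prodMk
      simpa using (hasDerivAt_id (0:ℝ)).smul_const z
    have h3 : HasFDerivAt (fun p : ℝ × E => G (p.1, p.1 • p.2))
      (fderiv ℝ (fun p : ℝ × E => G (p.1, p.1 • p.2)) (0, z)) (0, z) :=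
      (((h.smooth.comp (by fun_prop) :
        ContDiff ℝ ∞ (fun p : ℝ × E => G (p.1, p.1 • p.2)))).differentiable (by simp) _).hasFDerivAt
    have h4 : HasDerivAt (fun t : ℝ => (t, z)) ((1:ℝ), (0:E)) 0 :=
      (hasDerivAt_id (0:ℝ)).prodMk (hasDerivAt_const _ _)
    have h5 := h3.comp_hasDerivAt (0:ℝ) h4
    have h6 := h5.unique h2
    rw [h6, ← h.lin, ← map_add]
    simp
  refine ⟨z₀, fun p => q (p.1, z₀ + p.2) - z₀ - p.2, ⟨?_, ?_, ?_⟩, ?_⟩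
  · have : ContDiff ℝ ∞ (fun p : ℝ × E => q (p.1, z₀ + p.2)) := hq.comp (by fun_prop)
    fun_prop
  · simp only [hq3, add_zero, sub_zero, ← hz]
    abel
  · intro v
    have hs : ContDiff ℝ ∞ (fun p : ℝ × E => q (p.1, z₀ + p.2) - z₀ - p.2) := by
      have : ContDiff ℝ ∞ (fun p : ℝ × E => q (p.1, z₀ + p.2)) := hq.comp (by fun_prop)
      fun_prop
    have h1 := (hs.differentiable (by simp) ((0:ℝ), (0:E))).hasFDerivAt
    have h2 := h1.comp (0:E) (hasFDerivAt_prodMk_right (0:ℝ) (0:E))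
    have h3 : ((fun p : ℝ × E => q (p.1, z₀ + p.2) - z₀ - p.2) ∘ fun y => ((0:ℝ), y)) =
        fun y => (B - ContinuousLinearMap.id ℝ E) y := by
      funext y
      simp only [Function.comp, hq3, ← hz, map_add, sub_apply,
        ContinuousLinearMap.id_apply]
      abel
    rw [h3] at h2
    have h4 := h2.unique ((B - ContinuousLinearMap.id ℝ E).hasFDerivAt)
    have h5 := congrArg (fun T : E →L[ℝ] E => T v) h4
    simpa using h5
  · intro t x
    have := hq1 t (z₀ + x)
    simp only [zero_smul, h.zero, zero_add] at this
    rw [this]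
    congr 1
    change q (t, z₀ + x) = z₀ + x + (q (t, z₀ + x) - z₀ - x)
    abel

end

section
variable {E : Type} [NormedAddCommGroup E] [NormedSpace ℝ E]

/-- The integral operator whose fixed points solve the equation. -/
noncomputable def auxPhi (H : ℝ × E → E) (n : ℕ) (X : ℝ → E) (t : ℝ) : E :=
  ∫ σ in (0:ℝ)..1, σ ^ n • H (t * σ, X (t * σ))

lemma auxPhi_continuous {H : ℝ × E → E} (hH : Continuous H) (n : ℕ) {X : ℝ → E}
    (hX : Continuous X) : Continuous (auxPhi H n X) := by
  unfold auxPhi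
  apply intervalIntegral.continuous_parametric_intervalIntegral_of_continuous'
  simp only [Function.uncurry_def]
  fun_prop

lemma aux_integral_bound {f : ℝ → E} {n : ℕ} {C : ℝ}
    (h : ∀ σ ∈ Ioc (0:ℝ) 1, ‖f σ‖ ≤ C) :
    ‖∫ σ in (0:ℝ)..1, σ ^ n • f σ‖ ≤ C / (n + 1) := by
  have h1 : ‖∫ σ in (0:ℝ)..1, σ ^ n • f σ‖ ≤ ∫ σ in (0:ℝ)..1, σ ^ n * C := by
    apply intervalIntegral.norm_integral_le_of_norm_le zero_le_one
    · filter_upwards with σ hσ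
      rw [norm_smul, norm_pow, Real.norm_eq_abs, abs_of_pos hσ.1]
      have := pow_pos hσ.1 n
      gcongr
      exact h σ hσ
    · exact (by fun_prop : Continuous fun σ : ℝ => σ ^ n * C).intervalIntegrable _ _
  refine h1.trans (le_of_eq ?_)
  rw [intervalIntegral.integral_mul_const, integral_pow]
  simp
  ring

lemma auxPhi_hasDerivAt [CompleteSpace E] {H : ℝ × E → E} (hH : Continuous H) (n : ℕ) {X : ℝ → E}
    (hX : Continuous X) {t : ℝ} (ht : 0 < t) :
    HasDerivAt (auxPhi H n X)
      (t⁻¹ • (H (t, X t) - ((n : ℝ) + 1) • auxPhi H n X t)) t := by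
  have hc : Continuous fun s : ℝ => s ^ n • H (s, X s) := by fun_prop
  have hform : ∀ s : ℝ, 0 < s → auxPhi H n X s =
      (s ^ (n + 1))⁻¹ • ∫ u in (0:ℝ)..s, u ^ n • H (u, X u) := by
    intro s hs
    have h1 := intervalIntegral.integral_comp_mul_left (a := 0) (b := 1)
      (fun u : ℝ => u ^ n • H (u, X u)) hs.ne'
    simp only [mul_zero, mul_one] at h1
    have h2 : ∀ σ : ℝ, (s * σ) ^ n • H (s * σ, X (s * σ)) =
        s ^ n • (σ ^ n • H (s * σ, X (s * σ))) := by
      intro σ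
      rw [mul_pow, mul_smul]
    simp only [h2, intervalIntegral.integral_smul] at h1
    have h3 : auxPhi H n X s = (s ^ n)⁻¹ • (s⁻¹ • ∫ u in (0:ℝ)..s, u ^ n • H (u, X u)) := by
      rw [← h1, smul_smul, inv_mul_cancel₀ (pow_pos hs n).ne', one_smul]
      rfl
    rw [h3, smul_smul, pow_succ, mul_inv]
  have hd1 : HasDerivAt (fun s => ∫ u in (0:ℝ)..s, u ^ n • H (u, X u)) (t ^ n • H (t, X t)) t :=
    intervalIntegral.integral_hasDerivAt_right (hc.intervalIntegrable _ _)
      hc.stronglyMeasurable.stronglyMeasurableAtFilter hc.continuousAt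
  have hd2 : HasDerivAt (fun s : ℝ => (s ^ (n + 1))⁻¹)
      (-(((n + 1 : ℕ) : ℝ) * t ^ n) / (t ^ (n + 1)) ^ 2) t := by
    have hp := (hasDerivAt_pow (n + 1) t).inv (pow_pos ht _).ne'
    rw [Nat.add_sub_cancel] at hp
    exact hp
  have hd3 := hd2.smul hd1
  have hd4 : HasDerivAt (auxPhi H n X) _ t := hd3.congr_of_eventuallyEq (by
    filter_upwards [lt_mem_nhds ht] with s hs using hform s hs)
  convert! hd4 using 1
  rw [hform t ht, smul_sub, smul_smul, smul_smul, smul_smul, sub_eq_add_neg, ← neg_smul]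
  have := ht.ne'
  congr 1
  · congr 1
    field_simp
    ring
  · congr 1
    push_cast
    field_simp
    ring

lemma AuxBB.exists_sol [CompleteSpace E] {G : ℝ × E → E} {B : E →L[ℝ] E} (h : AuxBB G B) (N : ℕ)
    (hN : ‖(N : ℝ) • ContinuousLinearMap.id ℝ E + B‖ < N) :
    ∃ δ x, AuxSol G δ x := by
  obtain ⟨K, hK1, hK2⟩ := exists_between hN
  obtain ⟨r, hr, hlip⟩ := h.lipN N hK1
  have hK0 : 0 ≤ K := (norm_nonneg _).trans hK1.le
  have hNpos : (0:ℝ) < N := hK0.trans_lt hK2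
  have hNpos' : 0 < N := by exact_mod_cast hNpos
  obtain ⟨n, rfl⟩ : ∃ n, N = n + 1 := ⟨N - 1, by omega⟩
  set H : ℝ × E → E := fun p => ((n + 1 : ℕ) : ℝ) • p.2 + G p with hHdef
  have hHc : Continuous H := by
    have := h.smooth.continuous
    fun_prop
  have hHlip : ∀ t x y, |t| ≤ r → ‖x‖ ≤ r → ‖y‖ ≤ r → ‖H (t, x) - H (t, y)‖ ≤ K * ‖x - y‖ := by
    intro t x y ht hx hy
    convert! hlip t x y ht hx hy using 2
    simp only [hHdef, smul_sub]
    abel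
  have hH0 : H (0, 0) = 0 := by simp [hHdef, h.zero]
  -- choose δ
  obtain ⟨η, hη, hηb⟩ : ∃ η > 0, ∀ t, |t| < η → ‖H (t, 0)‖ ≤ (((n + 1 : ℕ) : ℝ) - K) * r := by
    have hc : ContinuousAt (fun t : ℝ => H (t, 0)) 0 := by fun_prop
    rw [Metric.continuousAt_iff] at hc
    obtain ⟨η, hη, h1⟩ := hc ((((n + 1 : ℕ) : ℝ) - K) * r) (mul_pos (sub_pos.2 hK2) hr)
    refine ⟨η, hη, fun t ht => ?_⟩
    have := h1 (x := t) (by simpa using ht)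
    rw [hH0, dist_zero_right] at this
    exact this.le
  set δ := min r (η / 2) with hδdef
  have hδ : 0 < δ := lt_min hr (by positivity)
  have hδr : δ ≤ r := min_le_left _ _
  have hδη : δ < η := lt_of_le_of_lt (min_le_right _ _) (by linarith)
  have hHb : ∀ t x, |t| ≤ δ → ‖x‖ ≤ r → ‖H (t, x)‖ ≤ ((n + 1 : ℕ) : ℝ) * r := by
    intro t x ht hx
    have h1 := hHlip t x 0 (ht.trans hδr) hx (by simpa using hr.le)
    have h2 := hηb t (ht.trans_lt hδη)
    have h3 : H (t, x) = (H (t, x) - H (t, 0)) + H (t, 0) := by abel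
    rw [h3]
    refine (norm_add_le _ _).trans ?_
    rw [sub_zero] at h1
    nlinarith
  let ext : C(Icc (0:ℝ) δ, E) → ℝ → E := fun X t => X (projIcc 0 δ hδ.le t)
  have hextc : ∀ X, Continuous (ext X) := fun X => X.continuous.comp continuous_projIcc
  let Φ : C(Icc (0:ℝ) δ, E) → C(Icc (0:ℝ) δ, E) := fun X =>
    ⟨fun t => auxPhi H n (ext X) t, (auxPhi_continuous hHc n (hextc X)).comp continuous_subtype_val⟩
  have htσ : ∀ t : Icc (0:ℝ) δ, ∀ σ ∈ Ioc (0:ℝ) 1, |(t:ℝ) * σ| ≤ δ := by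
    intro t σ hσ
    rw [abs_of_nonneg (mul_nonneg t.2.1 hσ.1.le)]
    nlinarith [t.2.1, t.2.2, hσ.1, hσ.2]
  let S : Set C(Icc (0:ℝ) δ, E) := Metric.closedBall 0 r
  have hSb : ∀ X ∈ S, ∀ t, ‖ext X t‖ ≤ r := by
    intro X hX t
    exact (X.norm_coe_le_norm _).trans (mem_closedBall_zero_iff.1 hX)
  have hmaps : MapsTo Φ S S := by
    intro X hX
    refine mem_closedBall_zero_iff.2 ?_
    rw [ContinuousMap.norm_le _ hr.le]
    intro t
    have h1 := aux_integral_bound (f := fun σ => H (t * σ, ext X (t * σ))) (n := n)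
      (C := ((n + 1 : ℕ) : ℝ) * r) (fun σ hσ => hHb _ _ (htσ t σ hσ) (hSb X hX _))
    refine h1.trans (le_of_eq ?_)
    push_cast
    field_simp
  have hdist : ∀ X ∈ S, ∀ Y ∈ S, dist (Φ X) (Φ Y) ≤ (K / (n + 1)) * dist X Y := by
    intro X hX Y hY
    rw [ContinuousMap.dist_le (by positivity)]
    intro t
    rw [dist_eq_norm]
    have hXc := hextc X
    have hYc := hextc Y
    have h0 : Φ X t - Φ Y t =
        ∫ σ in (0:ℝ)..1, σ ^ n • (H (t * σ, ext X (t * σ)) - H (t * σ, ext Y (t * σ))) := by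
      simp only [smul_sub]
      rw [intervalIntegral.integral_sub]
      · rfl
      · exact (by fun_prop : Continuous fun σ : ℝ =>
          σ ^ n • H (t * σ, ext X (t * σ))).intervalIntegrable _ _
      · exact (by fun_prop : Continuous fun σ : ℝ =>
          σ ^ n • H (t * σ, ext Y (t * σ))).intervalIntegrable _ _
    rw [h0]
    have h1 := aux_integral_bound
      (f := fun σ => H (t * σ, ext X (t * σ)) - H (t * σ, ext Y (t * σ))) (n := n)
      (C := K * dist X Y) (fun σ hσ => by
        refine (hHlip _ _ _ ((htσ t σ hσ).trans hδr) (hSb X hX _) (hSb Y hY _)).trans ?_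
        gcongr
        rw [← dist_eq_norm]
        exact ContinuousMap.dist_apply_le_dist _)
    refine h1.trans (le_of_eq ?_)
    ring
  have hKlt : K / (n + 1) < 1 := by
    rw [div_lt_one (by positivity)]
    exact_mod_cast hK2
  have hKnn : 0 ≤ K / ((n:ℝ) + 1) := by positivity
  have hcontr : ContractingWith ⟨K / (n + 1), hKnn⟩ (hmaps.restrict Φ S S) := by
    refine ⟨by exact_mod_cast hKlt, LipschitzWith.of_dist_le_mul ?_⟩
    intro X Y
    exact hdist X X.2 Y Y.2
  obtain ⟨X, hXS, hfix, -⟩ := hcontr.exists_fixedPoint' (Metric.isClosed_closedBall.isComplete) hmaps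
    (x := 0) (Metric.mem_closedBall_self hr.le) (edist_ne_top _ _)
  have hval : ∀ t ∈ Icc (0:ℝ) δ, ext X t = auxPhi H n (ext X) t := by
    intro t ht
    have h1 := congrArg (fun Y : C(Icc (0:ℝ) δ, E) => Y ⟨t, ht⟩) hfix
    simp only [ext]
    rw [projIcc_of_mem hδ.le ht]
    exact h1.symm
  refine ⟨δ, ext X, hδ, (hextc X).continuousOn, ?_, ?_⟩
  · have h1 := hval 0 ⟨le_rfl, hδ.le⟩
    have h2 := aux_integral_bound (f := fun σ => H (0 * σ, ext X (0 * σ))) (n := n)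
      (C := K * ‖ext X 0‖) (fun σ hσ => by
        have := hHlip 0 (ext X 0) 0 (by simpa using hr.le) (hSb X hXS _) (by simpa using hr.le)
        simpa [hH0] using this)
    have h3 : ‖ext X 0‖ ≤ K * ‖ext X 0‖ / (n + 1) := by
      calc ‖ext X 0‖ = ‖auxPhi H n (ext X) 0‖ := by rw [← h1]
        _ ≤ _ := h2
    rw [mul_div_right_comm] at h3
    have h4 := norm_nonneg (ext X 0)
    have h5 : ‖ext X 0‖ = 0 := by nlinarith
    exact norm_eq_zero.1 h5
  · intro t ht
    have h1 := auxPhi_hasDerivAt hHc n (hextc X) ht.1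
    have h2 : HasDerivAt (ext X) _ t := h1.congr_of_eventuallyEq (by
      filter_upwards [Ioo_mem_nhds ht.1 ht.2] with s hs using hval s ⟨hs.1.le, hs.2.le⟩)
    convert! h2 using 1
    rw [← hval t ⟨ht.1.le, ht.2.le⟩]
    simp only [hHdef]
    push_cast
    congr 1
    abel
end

section
variable {E : Type} [NormedAddCommGroup E] [NormedSpace ℝ E]

lemma AuxSol.lift {G G₂ : ℝ × E → E} {z₀ : E}
    (hrel : ∀ t x, G (t, t • (z₀ + x)) = t • (z₀ + x + G₂ (t, x))) {δ : ℝ} {u : ℝ → E}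
    (hu : AuxSol G₂ δ u) : AuxSol G δ (fun t => t • (z₀ + u t)) := by
  refine ⟨hu.pos, ?_, by simp, ?_⟩
  · have := hu.cont
    fun_prop
  · intro t ht
    have h1 := (hasDerivAt_id t).smul ((hu.deriv t ht).const_add z₀)
    convert! h1 using 1
    rw [hrel]
    simp only [id, smul_smul, inv_mul_cancel₀ ht.1.ne', mul_inv_cancel₀ ht.1.ne', one_smul]
    abel

lemma AuxSol.interior {G : ℝ × E → E} (hG : ContDiff ℝ ∞ G) {δ : ℝ} {x : ℝ → E}
    (h : AuxSol G δ x) (m : ℕ) : ContDiffOn ℝ m x (Ioo 0 δ) := by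
  induction m with
  | zero =>
    simp only [Nat.cast_zero, contDiffOn_zero]
    exact h.cont.mono Ioo_subset_Ico_self
  | succ m ih =>
    rw [Nat.cast_add, Nat.cast_one, contDiffOn_succ_iff_deriv_of_isOpen isOpen_Ioo]
    refine ⟨fun t ht => (h.deriv t ht).differentiableAt.differentiableWithinAt, by simp, ?_⟩
    have h1 : ContDiffOn ℝ m (fun t => t⁻¹ • G (t, x t)) (Ioo 0 δ) := by
      apply ContDiffOn.smul
      · exact contDiffOn_inv ℝ |>.mono (fun t ht => ht.1.ne')
      · exact (hG.of_le (by exact_mod_cast le_top)).comp_contDiffOn (contDiffOn_id.prodMk ih)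
    exact h1.congr (fun t ht => (h.deriv t ht).deriv)

lemma aux_unit_step {B : E →L[ℝ] E}
    (hB : ∀ h : ℕ, 1 ≤ h → IsUnit ((h : ℝ) • ContinuousLinearMap.id ℝ E - B)) :
    ∀ h : ℕ, 1 ≤ h → IsUnit ((h : ℝ) • ContinuousLinearMap.id ℝ E -
      (B - ContinuousLinearMap.id ℝ E)) := by
  intro h hh
  convert! hB (h + 1) (by omega) using 1
  push_cast
  rw [add_smul, one_smul]
  abel

lemma aux_diss_step {B : E →L[ℝ] E} {N : ℕ}
    (hN : ‖(N : ℝ) • ContinuousLinearMap.id ℝ E + B‖ < N) :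
    ‖((N + 1 : ℕ) : ℝ) • ContinuousLinearMap.id ℝ E + (B - ContinuousLinearMap.id ℝ E)‖
      < (N + 1 : ℕ) := by
  have : ((N + 1 : ℕ) : ℝ) • ContinuousLinearMap.id ℝ E + (B - ContinuousLinearMap.id ℝ E) =
      (N : ℝ) • ContinuousLinearMap.id ℝ E + B := by
    push_cast
    rw [add_smul, one_smul]
    abel
  rw [this]
  push_cast
  linarith

lemma AuxBB.regular [FiniteDimensional ℝ E] (m : ℕ) :
    ∀ {G : ℝ × E → E} {B : E →L[ℝ] E} (_ : AuxBB G B) (N : ℕ)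
    (_ : ‖(N : ℝ) • ContinuousLinearMap.id ℝ E + B‖ < N)
    (_ : ∀ h : ℕ, 1 ≤ h → IsUnit ((h : ℝ) • ContinuousLinearMap.id ℝ E - B))
    {δ : ℝ} {x : ℝ → E} (_ : AuxSol G δ x), ∃ δ' > 0, ContDiffOn ℝ m x (Ico 0 δ') := by
  have hcs : CompleteSpace E := FiniteDimensional.complete ℝ E
  induction m with
  | zero =>
    intro G B h N hN hB δ x hx
    exact ⟨δ, hx.pos, by simpa using hx.cont⟩
  | succ m ih =>
    intro G B h N hN hB δ x hx
    obtain ⟨z₀, G₂, h₂, hrel⟩ := h.blowup (hB 1 le_rfl)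
    obtain ⟨δ₂, u, hu⟩ := h₂.exists_sol (N + 1) (aux_diss_step hN)
    obtain ⟨δ₃, hδ₃, hu2⟩ := ih h₂ (N + 1) (aux_diss_step hN) (aux_unit_step hB) hu
    have hlift := hu.lift hrel
    obtain ⟨δ₄, hδ₄, h41, h42, heq⟩ := h.unique N hN hx hlift
    have hpos : 0 < min δ₃ δ₄ := lt_min hδ₃ hδ₄
    refine ⟨min δ₃ δ₄, hpos, ?_⟩
    have hud : UniqueDiffOn ℝ (Ico 0 (min δ₃ δ₄)) := uniqueDiffOn_Ico _ _
    have hder : ∀ t ∈ Ico 0 (min δ₃ δ₄),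
        HasDerivWithinAt x (z₀ + u t + G₂ (t, u t)) (Ico 0 (min δ₃ δ₄)) t := by
      intro t ht
      have ht2 := ht.2
      rw [lt_min_iff] at ht2
      rcases eq_or_lt_of_le ht.1 with h0 | h0
      · subst h0
        have hcu : ContinuousWithinAt (fun t => z₀ + u t) (Ico 0 (min δ₃ δ₄)) 0 :=
          continuousWithinAt_const.add ((hu2.continuousOn 0 ⟨le_rfl, hδ₃⟩).mono
            (Ico_subset_Ico_right (min_le_left _ _)))
        rw [hu.zero, h₂.zero, add_zero, hasDerivWithinAt_iff_tendsto_slope]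
        have hc2 : Tendsto (fun t => z₀ + u t) (𝓝[Ico 0 (min δ₃ δ₄) \ {0}] 0) (𝓝 (z₀ + 0)) := by
          rw [← hu.zero]
          exact hcu.mono_left (nhdsWithin_mono _ sdiff_subset)
        rw [add_zero] at hc2 ⊢
        refine hc2.congr' ?_
        filter_upwards [self_mem_nhdsWithin] with s hs
        have hs0 : s ≠ 0 := hs.2
        have hs2 := hs.1.2
        rw [lt_min_iff] at hs2
        rw [slope_def_module, hx.zero, heq ⟨hs.1.1, hs2.2⟩]
        simp [smul_smul, hs0]
      · have h5 := (hx.deriv t ⟨h0, ht2.2.trans_le h41⟩).hasDerivWithinAt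
          (s := Ico 0 (min δ₃ δ₄))
        convert! h5 using 1
        rw [heq ⟨ht.1, ht2.2⟩]
        simp only [hrel, smul_smul, inv_mul_cancel₀ h0.ne', one_smul]
    rw [Nat.cast_add, Nat.cast_one, contDiffOn_succ_iff_derivWithin hud]
    refine ⟨fun t ht => (hder t ht).differentiableWithinAt, by simp, ?_⟩
    have hu3 : ContDiffOn ℝ m u (Ico 0 (min δ₃ δ₄)) :=
      hu2.mono (Ico_subset_Ico_right (min_le_left _ _))
    have h1 : ContDiffOn ℝ m (fun t => z₀ + u t + G₂ (t, u t)) (Ico 0 (min δ₃ δ₄)) := by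
      apply (contDiffOn_const.add hu3).add
      exact (h₂.smooth.of_le (by exact_mod_cast le_top)).comp_contDiffOn (contDiffOn_id.prodMk hu3)
    exact h1.congr (fun t ht => (hder t ht).derivWithin (hud t ht))

lemma AuxBB.regular_infty [FiniteDimensional ℝ E] {G : ℝ × E → E} {B : E →L[ℝ] E} (h : AuxBB G B)
    (N : ℕ) (hN : ‖(N : ℝ) • ContinuousLinearMap.id ℝ E + B‖ < N)
    (hB : ∀ h : ℕ, 1 ≤ h → IsUnit ((h : ℝ) • ContinuousLinearMap.id ℝ E - B))
    {δ : ℝ} {x : ℝ → E} (hx : AuxSol G δ x) : ContDiffOn ℝ ∞ x (Ico 0 δ) := by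
  rw [contDiffOn_infty]
  intro m t ht
  rcases eq_or_lt_of_le ht.1 with h0 | h0
  · subst h0
    obtain ⟨δ', hδ', h1⟩ := AuxBB.regular m h N hN hB hx
    refine (h1 0 ⟨le_rfl, hδ'⟩).mono_of_mem_nhdsWithin ?_
    have : Ico 0 δ ∩ Iio δ' ∈ 𝓝[Ico 0 δ] 0 :=
      inter_mem_nhdsWithin _ (Iio_mem_nhds hδ')
    exact mem_of_superset this (fun s hs => ⟨hs.1.1, hs.2⟩)
  · have h1 := (hx.interior h.smooth m).contDiffAt (Ioo_mem_nhds h0 ht.2)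
    exact h1.contDiffWithinAt

lemma AuxBB.exists_smooth_aux [FiniteDimensional ℝ E] (n : ℕ) :
    ∀ {G : ℝ × E → E} {B : E →L[ℝ] E} (_ : AuxBB G B) (N : ℕ)
    (_ : ‖(N : ℝ) • ContinuousLinearMap.id ℝ E + (B - (n : ℝ) • ContinuousLinearMap.id ℝ E)‖ < N)
    (_ : ∀ h : ℕ, 1 ≤ h → IsUnit ((h : ℝ) • ContinuousLinearMap.id ℝ E - B)),
    ∃ δ x, AuxSol G δ x ∧ ContDiffOn ℝ ∞ x (Ico 0 δ) := by
  have hcs : CompleteSpace E := FiniteDimensional.complete ℝ E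
  induction n with
  | zero =>
    intro G B h N hN hB
    simp only [Nat.cast_zero, zero_smul, sub_zero] at hN
    obtain ⟨δ, x, hx⟩ := h.exists_sol N hN
    exact ⟨δ, x, hx, h.regular_infty N hN hB hx⟩
  | succ n ih =>
    intro G B h N hN hB
    obtain ⟨z₀, G₂, h₂, hrel⟩ := h.blowup (hB 1 le_rfl)
    obtain ⟨δ, u, hu, hus⟩ := ih h₂ N (by
      convert! hN using 3
      push_cast
      rw [add_smul, one_smul]
      abel) (aux_unit_step hB)
    refine ⟨δ, _, hu.lift hrel, ?_⟩
    exact contDiffOn_id.smul (contDiffOn_const.add hus)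

lemma AuxBB.exists_smooth [FiniteDimensional ℝ E] {G : ℝ × E → E} {B : E →L[ℝ] E} (h : AuxBB G B)
    (hB : ∀ h : ℕ, 1 ≤ h → IsUnit ((h : ℝ) • ContinuousLinearMap.id ℝ E - B)) :
    ∃ δ x, AuxSol G δ x ∧ ContDiffOn ℝ ∞ x (Ico 0 δ) := by
  obtain ⟨n, hn⟩ := exists_nat_gt ‖B‖
  exact AuxBB.exists_smooth_aux n h n (by simpa using hn) hB

lemma aux_taylor {f : ℝ → E} {b : ℝ} (hb : 0 < b) (hf : ContDiffOn ℝ ∞ f (Ico 0 b)) (n : ℕ)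
    (hz : ∀ k < n, iteratedDerivWithin k f (Ico 0 b) 0 = 0) :
    Tendsto (fun t => (t ^ n)⁻¹ • f t) (𝓝[>] 0)
      (𝓝 ((n.factorial : ℝ)⁻¹ • iteratedDerivWithin n f (Ico 0 b) 0)) := by
  have h1 := taylor_tendsto (n := n) (convex_Ico 0 b) ⟨le_rfl, hb⟩
    (hf.of_le (by exact_mod_cast le_top))
  have h2 : Tendsto (fun t => (t ^ n)⁻¹ • (f t - taylorWithinEval f n (Ico 0 b) 0 t)) (𝓝[>] 0)
      (𝓝 0) := by
    simp only [sub_zero] at h1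
    refine h1.mono_left ?_
    rw [← nhdsWithin_Ioo_eq_nhdsGT hb]
    exact nhdsWithin_mono _ Ioo_subset_Ico_self
  have h3 := h2.add_const ((n.factorial : ℝ)⁻¹ • iteratedDerivWithin n f (Ico 0 b) 0)
  rw [zero_add] at h3
  refine h3.congr' ?_
  filter_upwards [self_mem_nhdsWithin] with t ht
  have ht0 : t ^ n ≠ 0 := (pow_pos ht n).ne'
  rw [taylor_within_apply, Finset.sum_range_succ, Finset.sum_eq_zero, zero_add, sub_zero, smul_sub,
    smul_smul]
  · have : (t ^ n)⁻¹ * ((n.factorial : ℝ)⁻¹ * t ^ n) = (n.factorial : ℝ)⁻¹ := by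
      field_simp
    rw [this]
    abel
  · intro k hk
    rw [hz k (Finset.mem_range.1 hk), smul_zero]

lemma AuxBB.unique_smooth {G : ℝ × E → E} {B : E →L[ℝ] E} (h : AuxBB G B)
    (hB : ∀ h : ℕ, 1 ≤ h → IsUnit ((h : ℝ) • ContinuousLinearMap.id ℝ E - B))
    {b : ℝ} {x₁ x₂ : ℝ → E}
    (h₁ : AuxSol G b x₁) (h₂ : AuxSol G b x₂)
    (s₁ : ContDiffOn ℝ ∞ x₁ (Ico 0 b)) (s₂ : ContDiffOn ℝ ∞ x₂ (Ico 0 b)) :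
    ∃ δ > 0, EqOn x₁ x₂ (Ico 0 δ) := by
  have hb := h₁.pos
  set w : ℝ → E := fun t => x₁ t - x₂ t with hw
  have hws : ContDiffOn ℝ ∞ w (Ico 0 b) := s₁.sub s₂
  have hud : UniqueDiffOn ℝ (Ico 0 b) := uniqueDiffOn_Ico _ _
  have hws' : ContDiffOn ℝ ∞ (derivWithin w (Ico 0 b)) (Ico 0 b) :=
    ((contDiffOn_infty_iff_derivWithin hud).1 hws).2
  have hwd : ∀ t ∈ Ioo 0 b, HasDerivAt w (t⁻¹ • (G (t, x₁ t) - G (t, x₂ t))) t := by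
    intro t ht
    rw [smul_sub]
    exact (h₁.deriv t ht).sub (h₂.deriv t ht)
  have hwd' : ∀ t ∈ Ioo 0 b,
      derivWithin w (Ico 0 b) t = t⁻¹ • (G (t, x₁ t) - G (t, x₂ t)) := fun t ht =>
    (hwd t ht).hasDerivWithinAt.derivWithin (hud t (Ioo_subset_Ico_self ht))
  have hest : ∀ c > 0, ∀ᶠ t in 𝓝[>] 0, t ∈ Ioo 0 b ∧
      ‖G (t, x₁ t) - G (t, x₂ t) - B (w t)‖ ≤ c * ‖w t‖ := by
    intro c hc
    obtain ⟨r, hr, hlip⟩ := h.lip hc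
    obtain ⟨a, ha, ha1, ha2, ha3⟩ := h₁.small hr
    obtain ⟨a', ha', ha1', ha2', ha3'⟩ := h₂.small hr
    filter_upwards [Ioo_mem_nhdsGT ha, Ioo_mem_nhdsGT ha'] with t ht ht'
    refine ⟨⟨ht.1, ht.2.trans_le ha1⟩, ?_⟩
    exact hlip t _ _ (by rw [abs_of_pos ht.1]; linarith [ht.2]) (ha3 t ⟨ht.1.le, ht.2⟩)
      (ha3' t ⟨ht'.1.le, ht'.2⟩)
  have hzero : ∀ n, iteratedDerivWithin n w (Ico 0 b) 0 = 0 := by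
    intro n
    induction n using Nat.strong_induction_on with
    | _ n ih =>
      rcases Nat.eq_zero_or_pos n with hn | hn
      · subst hn
        simp [hw, h₁.zero, h₂.zero]
      · obtain ⟨m, rfl⟩ : ∃ m, n = m + 1 := ⟨n - 1, by omega⟩
        set d := iteratedDerivWithin (m + 1) w (Ico 0 b) 0 with hd
        set a := ((m + 1).factorial : ℝ)⁻¹ • d with ha
        have t1 : Tendsto (fun t => (t ^ (m + 1))⁻¹ • w t) (𝓝[>] 0) (𝓝 a) :=
          aux_taylor hb hws (m + 1) ih
        have t2 : Tendsto (fun t => (t ^ m)⁻¹ • derivWithin w (Ico 0 b) t) (𝓝[>] 0)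
            (𝓝 (((m + 1 : ℕ) : ℝ) • a)) := by
          have := aux_taylor hb hws' m (fun k hk => by
            rw [← iteratedDerivWithin_succ']
            exact ih (k + 1) (by omega))
          convert! this using 2
          rw [← iteratedDerivWithin_succ', ha, smul_smul, Nat.factorial_succ]
          congr 1
          push_cast
          have : (m.factorial : ℝ) ≠ 0 := by positivity
          field_simp
        have t3 : Tendsto (fun t => ‖(t ^ m)⁻¹ • derivWithin w (Ico 0 b) t -
            B ((t ^ (m + 1))⁻¹ • w t)‖) (𝓝[>] 0) (𝓝 ‖((m + 1 : ℕ) : ℝ) • a - B a‖) :=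
          (t2.sub ((B.continuous.tendsto a).comp t1)).norm
        have hle : ∀ c > 0, ‖((m + 1 : ℕ) : ℝ) • a - B a‖ ≤ c * ‖a‖ := by
          intro c hc
          refine le_of_tendsto_of_tendsto t3 (t1.norm.const_mul c) ?_
          filter_upwards [hest c hc] with t ht
          obtain ⟨ht, hb2⟩ := ht
          have e1 : (t ^ m)⁻¹ • derivWithin w (Ico 0 b) t - B ((t ^ (m + 1))⁻¹ • w t) =
              (t ^ (m + 1))⁻¹ • (G (t, x₁ t) - G (t, x₂ t) - B (w t)) := by
            rw [hwd' t ht, map_smul, smul_smul, smul_sub _ (G (t, x₁ t) - G (t, x₂ t)), pow_succ,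
              mul_inv]
          rw [e1, norm_smul, norm_smul]
          calc _ ≤ ‖(t ^ (m + 1))⁻¹‖ * (c * ‖w t‖) := by gcongr
            _ = _ := by ring
        have hnull : ((m + 1 : ℕ) : ℝ) • a - B a = 0 := by
          have : ‖((m + 1 : ℕ) : ℝ) • a - B a‖ ≤ 0 := by
            have tl : Tendsto (fun c : ℝ => c * ‖a‖) (𝓝[>] 0) (𝓝 (0 * ‖a‖)) :=
              ((continuous_id.mul continuous_const).tendsto (0:ℝ)).mono_left nhdsWithin_le_nhds
            rw [zero_mul] at tl
            refine ge_of_tendsto tl ?_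
            filter_upwards [self_mem_nhdsWithin] with c hc using hle c hc
          exact norm_le_zero_iff.1 this
        have ha0 : a = 0 := by
          obtain ⟨u, hu⟩ := hB (m + 1) (by omega)
          have h1 : (↑u⁻¹ * ↑u : E →L[ℝ] E) = 1 := u.inv_mul
          have h2 := congrArg (fun T : E →L[ℝ] E => T a) h1
          have h3 : (↑u : E →L[ℝ] E) a = 0 := by
            rw [hu]
            simpa using hnull
          calc a = (↑u⁻¹ : E →L[ℝ] E) ((↑u : E →L[ℝ] E) a) := h2.symm
            _ = 0 := by rw [h3, map_zero]
        rw [ha, smul_eq_zero] at ha0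
        rcases ha0 with h0 | h0
        · exact absurd h0 (by positivity)
        · exact h0
  obtain ⟨K, hK⟩ := exists_gt ‖(0:ℝ) • ContinuousLinearMap.id ℝ E + B‖
  obtain ⟨N, hN⟩ := exists_nat_gt K
  obtain ⟨r, hr, hlip⟩ := h.lipN 0 hK
  obtain ⟨a, ha, ha1, ha2, ha3⟩ := h₁.small hr
  obtain ⟨a', ha', ha1', ha2', ha3'⟩ := h₂.small hr
  have hO : ∀ᶠ t in 𝓝[>] (0:ℝ), ‖w t‖ ≤ 1 * t ^ N := by
    have h1 := (aux_taylor hb hws N (fun k _ => hzero k)).norm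
    rw [hzero N, smul_zero, norm_zero] at h1
    filter_upwards [h1.eventually_lt_const one_pos, self_mem_nhdsWithin] with t ht ht0
    have hp := pow_pos (mem_Ioi.1 ht0) N
    rw [norm_smul, norm_inv, Real.norm_eq_abs, abs_of_pos hp, inv_mul_lt_iff₀ hp] at ht
    linarith
  obtain ⟨η, hη, hη2⟩ := mem_nhdsGT_iff_exists_Ioo_subset.1 hO
  have hη0 : (0:ℝ) < η := hη
  refine ⟨min η (min a a'), lt_min hη0 (lt_min ha ha'), ?_⟩
  have hz := aux_gronwall (v := w) (v' := fun t => t⁻¹ • (G (t, x₁ t) - G (t, x₂ t)))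
    (δ := min η (min a a')) (C := 1) hN ?_ ?_ ?_
  · intro t ht
    rcases eq_or_lt_of_le ht.1 with h0 | h0
    · rw [← h0, h₁.zero, h₂.zero]
    · exact sub_eq_zero.1 (hz t ⟨h0, ht.2⟩)
  · intro t ht
    have ht2 := ht.2
    simp only [lt_min_iff] at ht2
    exact hwd t ⟨ht.1, ht2.2.1.trans_le ha1⟩
  · intro t ht
    have ht2 := ht.2
    simp only [lt_min_iff] at ht2
    have h3 := hlip t (x₁ t) (x₂ t) (by rw [abs_of_pos ht.1]; linarith)
      (ha3 t ⟨ht.1.le, ht2.2.1⟩) (ha3' t ⟨ht.1.le, ht2.2.2⟩)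
    rw [zero_smul, zero_add] at h3
    have hti := inv_pos.2 ht.1
    rw [norm_smul, norm_inv, Real.norm_eq_abs, abs_of_pos ht.1]
    gcongr
  · intro t ht
    have ht2 := ht.2
    simp only [lt_min_iff] at ht2
    exact hη2 ⟨ht.1, ht2.1⟩

lemma aux_globalize {X F : Type} [NormedAddCommGroup X] [NormedSpace ℝ X] [FiniteDimensional ℝ X]
    [NormedAddCommGroup F] [NormedSpace ℝ F] {f : X → F} {c : X}
    (hf : ∀ᶠ p in 𝓝 c, ContDiffAt ℝ ∞ f p) :
    ∃ g : X → F, ContDiff ℝ ∞ g ∧ g =ᶠ[𝓝 c] f := by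
  obtain ⟨R, hR, hR2⟩ := Metric.eventually_nhds_iff_ball.1 hf
  let χ : ContDiffBump c := ⟨R / 4, R / 2, by positivity, by linarith⟩
  refine ⟨fun p => χ p • f p, ?_, ?_⟩
  · rw [contDiff_iff_contDiffAt]
    intro p
    by_cases h1 : p ∈ tsupport χ
    swap
    · rw [notMem_tsupport_iff_eventuallyEq] at h1
      refine (contDiffAt_const (c := (0 : F))).congr_of_eventuallyEq ?_
      filter_upwards [h1] with q hq
      simp [hq]
    rw [χ.tsupport_eq] at h1
    refine χ.contDiffAt.smul (hR2 p ?_)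
    exact Metric.closedBall_subset_ball (by change R / 2 < R; linarith) h1
  · filter_upwards [χ.eventuallyEq_one] with p hp
    simp [hp]

end

section
variable {k : ℕ} {Mneg : (Fin k → ℝ) → (Fin k → ℝ)}
    {M : ℝ × (Fin k → ℝ) → (Fin k → ℝ)} {y₀ : Fin k → ℝ}

lemma aux_reduce
    (hMneg : ∃ U ∈ nhds y₀, ContDiffOn ℝ (⊤ : ℕ∞) Mneg U)
    (hM : ∃ V ∈ nhds ((0 : ℝ), y₀), ContDiffOn ℝ (⊤ : ℕ∞) M V)
    (h₀ : Mneg y₀ = 0) :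
    ∃ G : ℝ × (Fin k → ℝ) → (Fin k → ℝ), AuxBB G (fderiv ℝ Mneg y₀) ∧
      ∃ r > 0, ∀ t x, |t| ≤ r → ‖x‖ ≤ r → G (t, x) = Mneg (y₀ + x) + t • M (t, y₀ + x) := by
  obtain ⟨U, hU, hMU⟩ := hMneg
  obtain ⟨V, hV, hMV⟩ := hM
  have c1 : ∀ᶠ y in 𝓝 y₀, ContDiffAt ℝ ∞ Mneg y := by
    filter_upwards [eventually_mem_nhds_iff.2 hU] with y hy using hMU.contDiffAt hy
  have c2 : ∀ᶠ p in 𝓝 ((0:ℝ), y₀), ContDiffAt ℝ ∞ M p := by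
    filter_upwards [eventually_mem_nhds_iff.2 hV] with y hy using hMV.contDiffAt hy
  have l1 : Tendsto (fun p : ℝ × (Fin k → ℝ) => y₀ + p.2) (𝓝 (0, 0)) (𝓝 y₀) := by
    have : Continuous (fun p : ℝ × (Fin k → ℝ) => y₀ + p.2) := by fun_prop
    simpa using this.tendsto (0, 0)
  have l2 : Tendsto (fun p : ℝ × (Fin k → ℝ) => (p.1, y₀ + p.2)) (𝓝 (0, 0)) (𝓝 (0, y₀)) := by
    have : Continuous (fun p : ℝ × (Fin k → ℝ) => (p.1, y₀ + p.2)) := by fun_prop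
    simpa using this.tendsto (0, 0)
  obtain ⟨G, hG, hGe⟩ := aux_globalize (c := ((0:ℝ), (0 : Fin k → ℝ)))
    (f := fun p : ℝ × (Fin k → ℝ) => Mneg (y₀ + p.2) + p.1 • M (p.1, y₀ + p.2)) (by
      filter_upwards [l1.eventually c1, l2.eventually c2] with p hp1 hp2
      have e1 : ContDiffAt ℝ ∞ (fun p : ℝ × (Fin k → ℝ) => y₀ + p.2) p := by fun_prop
      have e2 : ContDiffAt ℝ ∞ (fun p : ℝ × (Fin k → ℝ) => (p.1, y₀ + p.2)) p := by fun_prop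
      exact (hp1.comp p e1).add (contDiffAt_fst.smul (hp2.comp p e2)))
  refine ⟨G, ⟨hG, ?_, ?_⟩, ?_⟩
  · rw [hGe.eq_of_nhds]
    simp [h₀]
  · intro v
    have h1 := (hG.differentiable (by simp) ((0:ℝ), (0 : Fin k → ℝ))).hasFDerivAt
    have h2 := h1.comp (0 : Fin k → ℝ) (hasFDerivAt_prodMk_right (0:ℝ) (0 : Fin k → ℝ))
    have h3 : HasFDerivAt (fun x => Mneg (y₀ + x)) (fderiv ℝ Mneg y₀) 0 := by
      have : HasFDerivAt Mneg (fderiv ℝ Mneg y₀) (y₀ + 0) := by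
        rw [add_zero]
        exact (c1.self_of_nhds.differentiableAt (by simp)).hasFDerivAt
      exact this.comp (0 : Fin k → ℝ) ((hasFDerivAt_id _).const_add y₀)
    have l3 : Tendsto (fun x : Fin k → ℝ => ((0:ℝ), x)) (𝓝 0) (𝓝 (0, 0)) := by
      have : Continuous (fun x : Fin k → ℝ => ((0:ℝ), x)) := by fun_prop
      exact this.tendsto 0
    have h4 := h3.congr_of_eventuallyEq (f₁ := G ∘ fun x => ((0:ℝ), x)) (by
      filter_upwards [l3.eventually hGe] with x hx
      simp only [Function.comp, hx]
      simp)
    have h5 := congrArg (fun T : (Fin k → ℝ) →L[ℝ] (Fin k → ℝ) => T v) (h2.unique h4)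
    simpa using h5
  · obtain ⟨R, hR, hR2⟩ := Metric.eventually_nhds_iff_ball.1 hGe
    refine ⟨R / 2, by positivity, fun t x ht hx => hR2 (t, x) ?_⟩
    rw [Metric.mem_ball, Prod.dist_eq, sup_lt_iff]
    simp only [dist_zero_right, Real.norm_eq_abs]
    constructor <;> linarith

lemma aux_to_sol {G : ℝ × (Fin k → ℝ) → (Fin k → ℝ)} {r : ℝ} (hr : 0 < r)
    (hG : ∀ t x, |t| ≤ r → ‖x‖ ≤ r → G (t, x) = Mneg (y₀ + x) + t • M (t, y₀ + x))
    {ε : ℝ} (hε : 0 < ε) {y : ℝ → (Fin k → ℝ)} (h : IsSingularIVPSolution Mneg M y₀ ε y) :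
    ∃ δ, AuxSol G δ (fun t => y t - y₀) ∧ ContDiffOn ℝ ∞ (fun t => y t - y₀) (Ico 0 δ) := by
  obtain ⟨hs, h0, hd⟩ := h
  have hc := hs.continuousOn 0 ⟨le_rfl, hε⟩
  rw [Metric.continuousWithinAt_iff] at hc
  obtain ⟨η, hη, h2⟩ := hc r hr
  have hsub : min η (min ε r) ≤ ε := (min_le_right _ _).trans (min_le_left _ _)
  have hs' : ContDiffOn ℝ ∞ (fun t => y t - y₀) (Ico 0 (min η (min ε r))) :=
    (hs.mono (Ico_subset_Ico_right hsub)).sub contDiffOn_const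
  refine ⟨min η (min ε r), ⟨lt_min hη (lt_min hε hr), hs'.continuousOn, by simp [h0], ?_⟩, hs'⟩
  intro t ht
  have ht2 := ht.2
  simp only [lt_min_iff] at ht2
  have hb := h2 (x := t) ⟨ht.1.le, ht2.2.1⟩ (by simpa [abs_of_pos ht.1] using ht2.1)
  rw [h0, dist_eq_norm] at hb
  have h3 := (hd t ⟨ht.1, ht2.2.1⟩).sub_const y₀
  convert! h3 using 1
  rw [hG t _ (by rw [abs_of_pos ht.1]; exact ht2.2.2.le) hb.le]
  simp [smul_smul, ht.1.ne']

lemma aux_of_sol {G : ℝ × (Fin k → ℝ) → (Fin k → ℝ)} {r : ℝ} (hr : 0 < r)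
    (hG : ∀ t x, |t| ≤ r → ‖x‖ ≤ r → G (t, x) = Mneg (y₀ + x) + t • M (t, y₀ + x))
    {δ : ℝ} {x : ℝ → (Fin k → ℝ)} (h : AuxSol G δ x) (hs : ContDiffOn ℝ ∞ x (Ico 0 δ)) :
    ∃ ε > 0, IsSingularIVPSolution Mneg M y₀ ε (fun t => y₀ + x t) := by
  obtain ⟨δ', hδ', h1, h2, h3⟩ := h.small hr
  refine ⟨δ', hδ', contDiffOn_const.add (hs.mono (Ico_subset_Ico_right h1)), by simp [h.zero], ?_⟩
  intro t ht
  have h4 := (h.deriv t ⟨ht.1, ht.2.trans_le h1⟩).const_add y₀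
  convert! h4 using 1
  rw [hG t _ (by rw [abs_of_pos ht.1]; linarith [ht.2]) (h3 t ⟨ht.1.le, ht.2⟩)]
  simp [smul_smul, ht.1.ne']

end

theorem singular_ivp_existence_uniqueness
    (k : ℕ) (Mneg : (Fin k → ℝ) → (Fin k → ℝ))
    (M : ℝ × (Fin k → ℝ) → (Fin k → ℝ)) (y₀ : Fin k → ℝ)
    (hMneg : ∃ U ∈ nhds y₀, ContDiffOn ℝ (⊤ : ℕ∞) Mneg U)
    (hM : ∃ V ∈ nhds ((0 : ℝ), y₀), ContDiffOn ℝ (⊤ : ℕ∞) M V)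
    (h₀ : Mneg y₀ = 0)
    (hinv : ∀ h : ℕ, 1 ≤ h →
      IsUnit ((h : ℝ) • (ContinuousLinearMap.id ℝ (Fin k → ℝ)) - fderiv ℝ Mneg y₀)) :
    (∃ ε > 0, ∃ y : ℝ → (Fin k → ℝ), IsSingularIVPSolution Mneg M y₀ ε y) ∧
    (∀ ε₁ ε₂ : ℝ, 0 < ε₁ → 0 < ε₂ → ∀ y₁ y₂ : ℝ → (Fin k → ℝ),
      IsSingularIVPSolution Mneg M y₀ ε₁ y₁ →
      IsSingularIVPSolution Mneg M y₀ ε₂ y₂ →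
      ∃ δ > 0, Set.EqOn y₁ y₂ (Set.Ico 0 δ)) := by
  obtain ⟨G, hBB, r, hr, hG⟩ := aux_reduce hMneg hM h₀
  constructor
  · obtain ⟨δ, x, hx, hxs⟩ := hBB.exists_smooth hinv
    obtain ⟨ε, hε, hsol⟩ := aux_of_sol hr hG hx hxs
    exact ⟨ε, hε, _, hsol⟩
  · intro ε₁ ε₂ hε₁ hε₂ y₁ y₂ hy₁ hy₂
    obtain ⟨δ₁, hx₁, hs₁⟩ := aux_to_sol hr hG hε₁ hy₁
    obtain ⟨δ₂, hx₂, hs₂⟩ := aux_to_sol hr hG hε₂ hy₂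
    have hpos : 0 < min δ₁ δ₂ := lt_min hx₁.pos hx₂.pos
    obtain ⟨δ, hδ, heq⟩ := hBB.unique_smooth hinv
      (hx₁.mono hpos (min_le_left _ _)) (hx₂.mono hpos (min_le_right _ _))
      (hs₁.mono (Ico_subset_Ico_right (min_le_left _ _)))
      (hs₂.mono (Ico_subset_Ico_right (min_le_right _ _)))
    exact ⟨δ, hδ, fun t ht => sub_left_injective (heq ht)⟩
end

section
/- For every v ∈ ℝ there exist ε > 0 and a smooth function r : [0, ε) → ℝ with r(0) = 0 and r'(0) = v such that for all t ∈ (0, ε): r''(t) + (1/2)·r'(t)·trace(P(t)⁻¹·P'(t)) − (1/2)·trace(P(t)⁻¹·P'(r(t))) = 0, where P'(r(t)) denotes the derivative of P evaluated at the point r(t); moreover r is unique in the sense that any two smooth solutions with the same initial data r(0) = 0, r'(0) = v agree on a neighborhood of 0. -/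
open Set Filter Matrix

/-- Entrywise derivative of a matrix-valued function of a real variable. -/
noncomputable def matDeriv {n m : Type*} (P : ℝ → Matrix n m ℝ) : ℝ → Matrix n m ℝ :=
  fun t => Matrix.of fun i j => deriv (fun s => P s i j) t

/-- The harmonic map equation solution predicate:
`r` is smooth on `[0, ε)`, `r(0) = 0`, `r'(0) = v` and
`r''(t) + ½ r'(t) tr(P(t)⁻¹ P'(t)) − ½ tr(P(t)⁻¹ P'(r(t))) = 0` on `(0, ε)`. -/
noncomputable def IsHarmonicSolution {p m : ℕ}
    (P : ℝ → Matrix (Fin p ⊕ Fin m) (Fin p ⊕ Fin m) ℝ) (v ε : ℝ) (r : ℝ → ℝ) : Prop :=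
  ContDiffOn ℝ (⊤ : ℕ∞) r (Set.Ico 0 ε) ∧ r 0 = 0 ∧ derivWithin r (Set.Ico 0 ε) 0 = v ∧
    ∀ t ∈ Set.Ioo 0 ε,
      deriv (deriv r) t
        + (1 / 2) * deriv r t * Matrix.trace ((P t)⁻¹ * matDeriv P t)
        - (1 / 2) * Matrix.trace ((P t)⁻¹ * matDeriv P (r t)) = 0

open scoped Topology

/-- Weighted average operator. -/
noncomputable def Av (q : ℕ) (H : ℝ → ℝ) (t : ℝ) : ℝ := ∫ σ in (0:ℝ)..1, σ ^ q * H (t * σ)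

lemma Av_continuous (q : ℕ) {H : ℝ → ℝ} (hH : Continuous H) : Continuous (Av q H) := by
  unfold Av
  apply intervalIntegral.continuous_parametric_intervalIntegral_of_continuous'
  simp only [Function.uncurry_def]
  fun_prop

lemma Av_zero (q : ℕ) (H : ℝ → ℝ) : Av q H 0 = H 0 / (q + 1) := by
  simp [Av, integral_pow]; ring

lemma Av_mul_pow (q : ℕ) (H : ℝ → ℝ) (t : ℝ) :
    t ^ (q + 1) * Av q H t = ∫ τ in (0:ℝ)..t, τ ^ q * H τ := by
  have h := intervalIntegral.mul_integral_comp_mul_left (a := 0) (b := 1)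
    (f := fun τ : ℝ => τ ^ q * H τ) t
  simp only [mul_zero, mul_one] at h
  rw [← h, pow_succ', mul_assoc, Av, ← intervalIntegral.integral_const_mul]
  congr 1
  congr 1
  ext σ
  ring

lemma Av_hasDerivAt (q : ℕ) {H H' : ℝ → ℝ} (hH : ∀ x, HasDerivAt H (H' x) x)
    (hH' : Continuous H') (t : ℝ) : HasDerivAt (Av q H) (Av (q + 1) H' t) t := by
  have hc : Continuous H := continuous_iff_continuousAt.2 fun x => (hH x).continuousAt
  obtain ⟨K, hK⟩ := (isCompact_Icc (a := -(|t|+1)) (b := |t|+1)).exists_bound_of_continuousOn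
    hH'.continuousOn
  refine (intervalIntegral.hasDerivAt_integral_of_dominated_loc_of_deriv_le
    (F := fun t σ => σ ^ q * H (t * σ)) (F' := fun t σ => σ ^ (q+1) * H' (t * σ))
    (bound := fun _ => K) (s := Metric.ball t 1)
    (Metric.ball_mem_nhds _ one_pos) ?_ ?_ ?_ ?_ ?_ ?_).2
  · refine Eventually.of_forall fun x => Continuous.aestronglyMeasurable (by fun_prop)
  · exact Continuous.intervalIntegrable (by fun_prop) _ _
  · exact Continuous.aestronglyMeasurable (by fun_prop)
  · refine Eventually.of_forall fun σ hσ x hx => ?_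
    rw [uIoc_of_le zero_le_one] at hσ
    have hx' : |x| ≤ |t| + 1 := by
      have h1 : |x - t| < 1 := hx
      have := abs_sub_abs_le_abs_sub x t
      linarith
    have h2 : |x * σ| ≤ |t| + 1 := by
      rw [abs_mul, abs_of_pos hσ.1]
      nlinarith [abs_nonneg x, hσ.2, hσ.1]
    have h3 := hK (x * σ) (abs_le.1 h2)
    rw [norm_mul, norm_pow, Real.norm_of_nonneg hσ.1.le]
    have : σ ^ (q+1) ≤ 1 := pow_le_one₀ hσ.1.le hσ.2
    nlinarith [norm_nonneg (H' (x * σ)), pow_pos hσ.1 (q+1)]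
  · exact intervalIntegrable_const
  · refine Eventually.of_forall fun σ hσ x hx => ?_
    have h1 : HasDerivAt (fun x => x * σ) σ x := by simpa using (hasDerivAt_id x).mul_const σ
    have h2 := ((hH (x * σ)).comp x h1).const_mul (σ ^ q)
    exact h2.congr_deriv (by ring)

lemma Av_contDiff (k : ℕ) : ∀ (q : ℕ) {H : ℝ → ℝ}, ContDiff ℝ k H → ContDiff ℝ k (Av q H) := by
  induction k with
  | zero =>
    intro q H hH
    exact contDiff_zero.2 (Av_continuous q (contDiff_zero.1 hH))
  | succ k ih =>
    intro q H hH
    push_cast at hH ⊢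
    obtain ⟨h1, -, h3⟩ := contDiff_succ_iff_deriv.1 hH
    have hd := fun t => Av_hasDerivAt q (fun x => (h1 x).hasDerivAt) h3.continuous t
    refine contDiff_succ_iff_deriv.2 ⟨fun t => (hd t).differentiableAt, by simp, ?_⟩
    rw [show deriv (Av q H) = Av (q+1) (deriv H) from funext fun t => (hd t).deriv]
    exact ih _ h3

lemma mul_Av_hasDerivAt (q : ℕ) {H : ℝ → ℝ} (hH : Continuous H) (t : ℝ) :
    HasDerivAt (fun t => t * Av q H t) (H t - q * Av q H t) t := by
  by_cases ht : t = 0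
  · subst ht
    have h0 : H 0 - q * Av q H 0 = Av q H 0 := by
      rw [Av_zero]; have : (q:ℝ) + 1 ≠ 0 := by positivity
      field_simp; ring
    rw [h0, hasDerivAt_iff_tendsto_slope]
    refine Tendsto.congr' ?_ (((Av_continuous q hH).tendsto 0).mono_left nhdsWithin_le_nhds)
    filter_upwards [self_mem_nhdsWithin] with x hx
    have : x ≠ 0 := hx
    simp [slope_def_field]; field_simp
  · have h1 : HasDerivAt (fun t => ∫ τ in (0:ℝ)..t, τ ^ q * H τ) (t ^ q * H t) t := by
      have hc : Continuous fun τ : ℝ => τ ^ q * H τ := by fun_prop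
      exact intervalIntegral.integral_hasDerivAt_right (hc.intervalIntegrable _ _)
        (hc.stronglyMeasurableAtFilter _ _) hc.continuousAt
    have h2 := h1.div (hasDerivAt_pow q t) (pow_ne_zero q ht)
    have h3 : (fun t => t * Av q H t) =ᶠ[𝓝 t]
        ((fun t => ∫ τ in (0:ℝ)..t, τ ^ q * H τ) / fun x => x ^ q) := by
      filter_upwards [isOpen_ne.mem_nhds ht] with x hx
      have : x ≠ 0 := hx
      simp only [Pi.div_apply, ← Av_mul_pow]
      field_simp
      ring
    refine (h2.congr_of_eventuallyEq h3).congr_deriv ?_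
    rw [← Av_mul_pow]
    rcases q with _ | q
    · simp
    · simp only [Nat.add_sub_cancel]
      field_simp
      ring

lemma contDiff_succ_of_hasDerivAt {k : ℕ} {f f' : ℝ → ℝ} (h : ∀ t, HasDerivAt f (f' t) t)
    (hf' : ContDiff ℝ k f') : ContDiff ℝ (k + 1 : ℕ) f := by
  push_cast
  refine contDiff_succ_iff_deriv.2 ⟨fun t => (h t).differentiableAt, by simp, ?_⟩
  rwa [show deriv f = f' from funext fun t => (h t).deriv]

/-- Existence for a globally smooth, small right-hand side. -/
lemma exists_fixed (q : ℕ) (v : ℝ) (h : ℝ × ℝ × ℝ → ℝ) (hh : ContDiff ℝ (⊤ : ℕ∞) h)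
    (M : ℝ) (hM : ∀ x, |h x| ≤ M) (L : ℝ) (hL : 0 ≤ L) (hL1 : L < 1)
    (hlip : ∀ t u w u' w' D, 0 ≤ D → |u - u'| ≤ |t| * D → |w - w'| ≤ |t| * D →
      |h (t, u, w) - h (t, u', w')| ≤ L * D) :
    ∃ z : ℝ → ℝ, Continuous z ∧
      ∀ t, z t = Av q (fun τ => h (τ, v + τ * Av 0 z τ, τ * z τ)) t := by
  have hM0 : 0 ≤ M := (abs_nonneg _).trans (hM 0)
  have hAvb : ∀ (q : ℕ) (H : ℝ → ℝ) (K : ℝ), (∀ x, |H x| ≤ K) → ∀ t, |Av q H t| ≤ K := by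
    intro q H K hK t
    have hK0 : 0 ≤ K := (abs_nonneg _).trans (hK 0)
    have := intervalIntegral.norm_integral_le_of_norm_le_const (a := 0) (b := 1)
      (f := fun σ : ℝ => σ ^ q * H (t * σ)) (C := K) (by
        intro σ hσ
        rw [uIoc_of_le zero_le_one] at hσ
        rw [norm_mul, norm_pow, Real.norm_of_nonneg hσ.1.le]
        have h1 : σ ^ q ≤ 1 := pow_le_one₀ hσ.1.le hσ.2
        have h2 := hK (t * σ)
        rw [Real.norm_eq_abs]
        nlinarith [abs_nonneg (H (t * σ)), pow_pos hσ.1 q])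
    simpa [Av] using this
  have hAvsub : ∀ (q : ℕ) (H G : ℝ → ℝ), Continuous H → Continuous G → ∀ t,
      Av q H t - Av q G t = Av q (fun x => H x - G x) t := by
    intro q H G hH hG t
    unfold Av
    rw [← intervalIntegral.integral_sub (Continuous.intervalIntegrable (by fun_prop) _ _)
      (Continuous.intervalIntegrable (by fun_prop) _ _)]
    congr 1; ext σ; ring
  have hc := hh.continuous
  have hcH : ∀ z : ℝ → ℝ, Continuous z →
      Continuous (fun τ => h (τ, v + τ * Av 0 z τ, τ * z τ)) := by
    intro z hz
    have := Av_continuous 0 hz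
    fun_prop
  let T : BoundedContinuousFunction ℝ ℝ → BoundedContinuousFunction ℝ ℝ := fun z =>
    BoundedContinuousFunction.ofNormedAddCommGroup
      (Av q (fun τ => h (τ, v + τ * Av 0 z τ, τ * z τ)))
      (Av_continuous q (hcH z z.continuous)) M (fun t => hAvb q _ M (fun x => hM _) t)
  have hT : ContractingWith ⟨L, hL⟩ T := by
    refine ⟨by exact_mod_cast hL1, LipschitzWith.of_dist_le_mul fun z y => ?_⟩
    have hzy : ∀ x, |z x - y x| ≤ dist z y := fun x => by
      rw [← Real.dist_eq]; exact BoundedContinuousFunction.dist_coe_le_dist x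
    refine (BoundedContinuousFunction.dist_le (by positivity)).2 fun t => ?_
    rw [Real.dist_eq]
    change |Av q (fun τ => h (τ, v + τ * Av 0 z τ, τ * z τ)) t
      - Av q (fun τ => h (τ, v + τ * Av 0 y τ, τ * y τ)) t| ≤ L * dist z y
    rw [hAvsub q _ _ (hcH z z.continuous) (hcH y y.continuous)]
    refine hAvb q _ _ (fun τ => ?_) t
    refine hlip _ _ _ _ _ _ dist_nonneg ?_ ?_
    · have : v + τ * Av 0 z τ - (v + τ * Av 0 y τ) = τ * (Av 0 z τ - Av 0 y τ) := by ring
      rw [this, abs_mul, hAvsub 0 _ _ z.continuous y.continuous]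
      exact mul_le_mul_of_nonneg_left (hAvb 0 _ _ hzy τ) (abs_nonneg _)
    · rw [← mul_sub, abs_mul]
      exact mul_le_mul_of_nonneg_left (hzy τ) (abs_nonneg _)
  refine ⟨hT.fixedPoint, (hT.fixedPoint).continuous, fun t => ?_⟩
  have := hT.fixedPoint_isFixedPt
  exact (congrArg (fun f : BoundedContinuousFunction ℝ ℝ => f t) this).symm

lemma smooth_solution (q : ℕ) (v : ℝ) (h : ℝ × ℝ × ℝ → ℝ) (hh : ContDiff ℝ (⊤ : ℕ∞) h)
    (M : ℝ) (hM : ∀ x, |h x| ≤ M) (L : ℝ) (hL : 0 ≤ L) (hL1 : L < 1)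
    (hlip : ∀ t u w u' w' D, 0 ≤ D → |u - u'| ≤ |t| * D → |w - w'| ≤ |t| * D →
      |h (t, u, w) - h (t, u', w')| ≤ L * D) :
    ∃ u z : ℝ → ℝ, ContDiff ℝ (⊤ : ℕ∞) u ∧ ContDiff ℝ (⊤ : ℕ∞) z ∧ u 0 = v ∧
      (∀ t, HasDerivAt u (z t) t) ∧
      (∀ t, HasDerivAt (fun t => t * z t) (h (t, u t, t * z t) - q * z t) t) := by
  obtain ⟨z, hz, hfix⟩ := exists_fixed q v h hh M hM L hL hL1 hlip
  set u : ℝ → ℝ := fun τ => v + τ * Av 0 z τ with hu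
  set H : ℝ → ℝ := fun τ => h (τ, u τ, τ * z τ) with hH
  have hfix' : z = Av q H := funext hfix
  have hu' : ∀ t, HasDerivAt u (z t) t := fun t => by
    exact ((mul_Av_hasDerivAt 0 hz t).const_add v).congr_deriv (by simp)
  have huc : Continuous u := continuous_iff_continuousAt.2 fun x => (hu' x).continuousAt
  have hHc : Continuous H := by
    have := hh.continuous
    simp only [hH]; fun_prop
  have hw : ∀ t, HasDerivAt (fun t => t * z t) (H t - q * z t) t := fun t => by
    have := mul_Av_hasDerivAt q hHc t
    rwa [← hfix'] at this
  have key : ∀ k : ℕ, ContDiff ℝ k z := by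
    intro k
    induction k with
    | zero => exact contDiff_zero.2 hz
    | succ k ih =>
      have hhk : ∀ k : ℕ, ContDiff ℝ k h := fun k => contDiff_infty.1 hh k
      have h1 : ContDiff ℝ (k+1:ℕ) u := contDiff_succ_of_hasDerivAt hu' ih
      have h1' : ContDiff ℝ k u := h1.of_le (by exact_mod_cast Nat.le_succ k)
      have h2 : ContDiff ℝ k H :=
        (hhk k).comp (contDiff_id.prodMk (h1'.prodMk (contDiff_id.mul ih)))
      have h3 : ContDiff ℝ (k+1:ℕ) (fun t => t * z t) :=
        contDiff_succ_of_hasDerivAt hw (h2.sub (contDiff_const.mul ih))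
      have h4 : ContDiff ℝ (k+1:ℕ) H :=
        (hhk (k+1)).comp (contDiff_id.prodMk (h1.prodMk h3))
      rw [hfix']
      exact Av_contDiff (k+1) q h4
  have hzs : ContDiff ℝ (⊤ : ℕ∞) z := contDiff_infty.2 key
  refine ⟨u, z, contDiff_infty.2 fun k => ?_, hzs, by simp [hu], hu', hw⟩
  exact (contDiff_succ_of_hasDerivAt hu' (key k)).of_le (by exact_mod_cast Nat.le_succ k)

/-- Smooth cutoff of the right-hand side near the initial point. -/
lemma exists_cutoff (x₀ : ℝ × ℝ × ℝ) (h : ℝ × ℝ × ℝ → ℝ) (hh : ContDiff ℝ (⊤ : ℕ∞) h) :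
    ∃ h₁ : ℝ × ℝ × ℝ → ℝ, ContDiff ℝ (⊤ : ℕ∞) h₁ ∧ h₁ =ᶠ[𝓝 x₀] h ∧
      (∃ M : ℝ, ∀ x, |h₁ x| ≤ M) ∧ ∃ L : ℝ, 0 ≤ L ∧ ∀ x y, |h₁ x - h₁ y| ≤ L * dist x y := by
  let φ : ContDiffBump x₀ := ⟨1, 2, one_pos, one_lt_two⟩
  have hc : HasCompactSupport (fun x => φ x * h x) := φ.hasCompactSupport.mul_right
  have hs : ContDiff ℝ (⊤ : ℕ∞) (fun x => φ x * h x) := φ.contDiff.mul hh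
  refine ⟨fun x => φ x * h x, hs, ?_, ?_, ?_⟩
  · filter_upwards [φ.eventuallyEq_one] with x hx
    simp [hx]
  · obtain ⟨M, hM⟩ := hc.exists_bound_of_continuous hs.continuous
    exact ⟨M, hM⟩
  · obtain ⟨L, hL⟩ := hs.lipschitzWith_of_hasCompactSupport hc (by simp)
    exact ⟨L, L.2, fun x y => by simpa [Real.dist_eq] using hL.dist_le_mul x y⟩

lemma local_existence (q : ℕ) (v : ℝ) (h : ℝ × ℝ × ℝ → ℝ) (hh : ContDiff ℝ (⊤ : ℕ∞) h) :
    ∃ u z : ℝ → ℝ, ContDiff ℝ (⊤ : ℕ∞) u ∧ ContDiff ℝ (⊤ : ℕ∞) z ∧ u 0 = v ∧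
      (∀ t, HasDerivAt u (z t) t) ∧
      (∀ᶠ t in 𝓝 0, HasDerivAt (fun t => t * z t) (h (t, u t, t * z t) - q * z t) t) := by
  obtain ⟨h₁, hs, heq, ⟨M, hM⟩, L, hL0, hL⟩ := exists_cutoff (0, v, 0) h hh
  set a : ℝ := 1 / (2 * (L + 1)) with ha
  have ha0 : 0 < a := by positivity
  let χ : ContDiffBump (0:ℝ) := ⟨a / 2, a, by positivity, by linarith⟩
  have hχ1 : ∀ t, |χ t| ≤ 1 := fun t => by rw [abs_of_nonneg χ.nonneg]; exact χ.le_one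
  have hLa : L * a < 1 := by
    rw [ha, mul_one_div, div_lt_one (by positivity)]; linarith
  obtain ⟨u, z, hu, hz, h0, hud, hw⟩ := smooth_solution q v (fun x => χ x.1 * h₁ x)
    ((χ.contDiff.comp contDiff_fst).mul hs) M (fun x => by
      rw [abs_mul]
      have := hM x
      have := hχ1 x.1
      nlinarith [abs_nonneg (h₁ x), abs_nonneg (χ x.1)]) (L * a) (by positivity) hLa
    (by
      intro t u w u' w' D hD0 h1 h2
      rw [← mul_sub, abs_mul]
      have h3 := hL (t, u, w) (t, u', w')
      have h4 : dist (t, u, w) (t, u', w') ≤ |t| * D := by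
        rw [Prod.dist_eq, Prod.dist_eq, dist_self, Real.dist_eq, Real.dist_eq]
        refine max_le ((abs_nonneg _).trans h1) (max_le h1 h2)
      by_cases hta : a ≤ |t|
      · have : χ t = 0 := χ.zero_of_le_dist (by simpa [Real.dist_eq] using hta)
        rw [this]
        simp only [abs_zero, zero_mul]
        positivity
      · push Not at hta
        have hD : |t| * D ≤ a * D := mul_le_mul_of_nonneg_right hta.le hD0
        have h5 : |h₁ (t, u, w) - h₁ (t, u', w')| ≤ L * a * D := by
          calc _ ≤ L * (|t| * D) := h3.trans (mul_le_mul_of_nonneg_left h4 hL0)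
            _ ≤ L * (a * D) := mul_le_mul_of_nonneg_left hD hL0
            _ = _ := by ring
        have := hχ1 t
        nlinarith [abs_nonneg (χ t), abs_nonneg (h₁ (t, u, w) - h₁ (t, u', w'))])
  refine ⟨u, z, hu, hz, h0, hud, ?_⟩
  have hT : Tendsto (fun t => (t, u t, t * z t)) (𝓝 0) (𝓝 (0, v, 0)) := by
    have hc : Continuous (fun t => (t, u t, t * z t)) := by
      have := hu.continuous
      have := hz.continuous
      fun_prop
    have := hc.tendsto 0
    simpa [h0] using this
  filter_upwards [hT.eventually heq, χ.eventuallyEq_one] with t h1 h2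
  have := hw t
  simp only [h1, h2, Pi.one_apply, one_mul] at this
  exact this

lemma mvt_zero {f f' : ℝ → ℝ} {K t : ℝ} (ht : 0 < t)
    (hf : ∀ s ∈ Ioc 0 t, HasDerivAt f (f' s) s) (hb : ∀ s ∈ Ioc 0 t, |f' s| ≤ K)
    (h0 : Tendsto f (𝓝[>] 0) (𝓝 0)) : |f t| ≤ K * t := by
  have hK : 0 ≤ K := (abs_nonneg _).trans (hb t ⟨ht, le_rfl⟩)
  have h1 : ∀ᶠ s in 𝓝[>] (0:ℝ), |f t - f s| ≤ K * t := by
    filter_upwards [Ioo_mem_nhdsGT ht] with s hs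
    have := norm_image_sub_le_of_norm_deriv_le_segment' (f := f) (f' := f') (a := s) (b := t) (C := K)
      (fun x hx => (hf x ⟨hs.1.trans_le hx.1, hx.2⟩).hasDerivWithinAt)
      (fun x hx => hb x ⟨hs.1.trans_le hx.1, hx.2.le⟩) t ⟨hs.2.le, le_rfl⟩
    refine this.trans (mul_le_mul_of_nonneg_left (by linarith [hs.1]) hK)
  have h2 : Tendsto (fun s => |f t - f s|) (𝓝[>] 0) (𝓝 |f t - 0|) :=
    (tendsto_const_nhds.sub h0).abs
  simpa using le_of_tendsto h2 h1

lemma local_uniqueness (p : ℕ) (v : ℝ) (h : ℝ × ℝ × ℝ → ℝ) (hh : ContDiff ℝ (⊤ : ℕ∞) h)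
    (u w : Fin 2 → ℝ → ℝ) (K : ℝ)
    (hu : ∀ i, ∀ᶠ t in 𝓝[>] 0, HasDerivAt (u i) (w i t / t) t)
    (hw : ∀ i, ∀ᶠ t in 𝓝[>] 0,
      HasDerivAt (w i) (-(p + 1) * w i t / t + h (t, u i t, w i t)) t)
    (hu0 : ∀ i, Tendsto (u i) (𝓝[>] 0) (𝓝 v))
    (hwK : ∀ i, ∀ᶠ t in 𝓝[>] 0, |w i t| ≤ K * t) :
    ∃ δ > 0, ∀ t ∈ Ioo 0 δ, u 0 t = u 1 t := by
  obtain ⟨h₁, hs, heq, -, L, hL0, hL⟩ := exists_cutoff (0, v, 0) h hh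
  have ht0 : Tendsto (fun t : ℝ => t) (𝓝[>] 0) (𝓝 0) := nhdsWithin_le_nhds
  have hw0 : ∀ i, Tendsto (w i) (𝓝[>] 0) (𝓝 0) := fun i => by
    refine squeeze_zero_norm' (hwK i) ?_
    simpa using ht0.const_mul K
  have hloc : ∀ i, ∀ᶠ t in 𝓝[>] 0, h₁ (t, u i t, w i t) = h (t, u i t, w i t) := fun i =>
    (ht0.prodMk_nhds ((hu0 i).prodMk_nhds (hw0 i))).eventually heq
  have hall : ∀ᶠ t in 𝓝[>] (0:ℝ), ∀ i, HasDerivAt (u i) (w i t / t) t ∧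
      HasDerivAt (w i) (-(p + 1) * w i t / t + h₁ (t, u i t, w i t)) t ∧ |w i t| ≤ K * t := by
    rw [eventually_all]
    intro i
    filter_upwards [hu i, hw i, hwK i, hloc i] with t a b c d
    exact ⟨a, by rw [d]; exact b, c⟩
  obtain ⟨a₀, ha₀, hall⟩ := mem_nhdsGT_iff_exists_Ioo_subset.1 hall
  have ha₀ : 0 < a₀ := ha₀
  set a : ℝ := min a₀ (1 / (2 * (L + 1))) with ha
  have ha0 : 0 < a := lt_min ha₀ (by positivity)
  have hLa : L * a ≤ 1 / 2 := by
    have : a ≤ 1 / (2 * (L + 1)) := min_le_right _ _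
    calc L * a ≤ L * (1 / (2 * (L + 1))) := mul_le_mul_of_nonneg_left this hL0
      _ ≤ 1 / 2 := by
        rw [mul_one_div, div_le_div_iff₀ (by positivity) (by positivity)]; linarith
  have hall' : ∀ t ∈ Ioo 0 a, ∀ i, HasDerivAt (u i) (w i t / t) t ∧
      HasDerivAt (w i) (-(p + 1) * w i t / t + h₁ (t, u i t, w i t)) t ∧ |w i t| ≤ K * t :=
    fun t ht => hall ⟨ht.1, ht.2.trans_le (min_le_left _ _)⟩
  have hU : ∀ D : ℝ, (∀ t ∈ Ioo 0 a, |w 0 t - w 1 t| ≤ D * t) →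
      ∀ t ∈ Ioo 0 a, |u 0 t - u 1 t| ≤ D * t := by
    intro D hD t ht
    refine mvt_zero (f := fun t => u 0 t - u 1 t) (f' := fun t => w 0 t / t - w 1 t / t) ht.1 ?_ ?_ ?_
    · intro s hs
      have hs' : s ∈ Ioo 0 a := ⟨hs.1, hs.2.trans_lt ht.2⟩
      exact (hall' s hs' 0).1.sub (hall' s hs' 1).1
    · intro s hs
      have hs' : s ∈ Ioo 0 a := ⟨hs.1, hs.2.trans_lt ht.2⟩
      rw [← sub_div, abs_div, abs_of_pos hs.1, div_le_iff₀ hs.1]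
      exact hD s hs'
    · simpa using (hu0 0).sub (hu0 1)
  have hstep : ∀ D : ℝ, (∀ t ∈ Ioo 0 a, |w 0 t - w 1 t| ≤ D * t) →
      ∀ t ∈ Ioo 0 a, |w 0 t - w 1 t| ≤ (D / 2) * t := by
    intro D hD t ht
    have hD0 : 0 ≤ D := by
      have := (abs_nonneg _).trans (hD t ht)
      by_contra hc
      nlinarith [ht.1]
    have key : |t ^ (p + 1) * (w 0 t - w 1 t)| ≤ (t ^ (p + 1) * (L * (D * t))) * t := by
      refine mvt_zero (f := fun t => t ^ (p + 1) * (w 0 t - w 1 t))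
        (f' := fun t => t ^ (p + 1) * (h₁ (t, u 0 t, w 0 t) - h₁ (t, u 1 t, w 1 t))) ht.1 ?_ ?_ ?_
      · intro s hs
        have hs' : s ∈ Ioo 0 a := ⟨hs.1, hs.2.trans_lt ht.2⟩
        have := (hasDerivAt_pow (p + 1) s).mul ((hall' s hs' 0).2.1.sub (hall' s hs' 1).2.1)
        refine this.congr_deriv ?_
        have := hs.1.ne'
        simp only [Nat.add_sub_cancel, Pi.sub_apply]
        push_cast
        field_simp
        ring
      · intro s hs
        have hs' : s ∈ Ioo 0 a := ⟨hs.1, hs.2.trans_lt ht.2⟩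
        rw [abs_mul, abs_of_pos (pow_pos hs.1 _)]
        refine mul_le_mul (pow_le_pow_left₀ hs.1.le hs.2 _) ?_ (abs_nonneg _) (pow_pos ht.1 _).le
        refine (hL _ _).trans (mul_le_mul_of_nonneg_left ?_ hL0)
        rw [Prod.dist_eq, Prod.dist_eq, dist_self, Real.dist_eq, Real.dist_eq]
        have hst : D * s ≤ D * t := mul_le_mul_of_nonneg_left hs.2 hD0
        have ht' := ht.1
        exact max_le (by positivity) (max_le ((hU D hD s hs').trans hst) ((hD s hs').trans hst))
      · have h1 : Tendsto (fun t : ℝ => t ^ (p + 1) * (w 0 t - w 1 t)) (𝓝[>] 0)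
            (𝓝 (0 ^ (p + 1) * (0 - 0))) := (ht0.pow _).mul ((hw0 0).sub (hw0 1))
        simpa using h1
    rw [abs_mul, abs_of_pos (pow_pos ht.1 _), mul_assoc] at key
    have key2 := le_of_mul_le_mul_left key (pow_pos ht.1 _)
    have : L * t ≤ 1 / 2 := (mul_le_mul_of_nonneg_left ht.2.le hL0).trans hLa
    have h5 : 0 ≤ D * t := mul_nonneg hD0 ht.1.le
    nlinarith
  have hn : ∀ n : ℕ, ∀ t ∈ Ioo 0 a, |w 0 t - w 1 t| ≤ (2 * K * (1 / 2) ^ n) * t := by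
    intro n
    induction n with
    | zero =>
      intro t ht
      have h1 := (hall' t ht 0).2.2
      have h2 := (hall' t ht 1).2.2
      have := abs_sub (w 0 t) (w 1 t)
      simp only [pow_zero, mul_one]
      linarith
    | succ n ih =>
      intro t ht
      have := hstep _ ih t ht
      rw [pow_succ]
      linarith
  refine ⟨a, ha0, fun t ht => ?_⟩
  have hlim : Tendsto (fun n : ℕ => (2 * K * (1 / 2 : ℝ) ^ n) * t) atTop (𝓝 0) := by
    have := ((tendsto_pow_atTop_nhds_zero_of_lt_one (r := (1/2:ℝ)) (by norm_num)
      (by norm_num)).const_mul (2 * K)).mul_const t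
    simpa using this
  have := ge_of_tendsto' hlim fun n => hU _ (hn n) t ht
  exact sub_eq_zero.1 (abs_eq_zero.1 (le_antisymm this (abs_nonneg _)))

/-- Entrywise smooth matrix family. -/
def SM {n m : Type*} (M : ℝ → Matrix n m ℝ) : Prop :=
  ∀ i j, ContDiff ℝ (⊤ : ℕ∞) fun t => M t i j

lemma SM.mul {l n m : Type*} [Fintype n] {M : ℝ → Matrix l n ℝ} {N : ℝ → Matrix n m ℝ}
    (hM : SM M) (hN : SM N) : SM (fun t => M t * N t) := fun i j => by
  simp only [Matrix.mul_apply]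
  exact ContDiff.sum fun k _ => (hM i k).mul (hN k j)

lemma SM.add {n m : Type*} {M N : ℝ → Matrix n m ℝ}
    (hM : SM M) (hN : SM N) : SM (fun t => M t + N t) := fun i j => (hM i j).add (hN i j)

lemma SM.sub {n m : Type*} {M N : ℝ → Matrix n m ℝ}
    (hM : SM M) (hN : SM N) : SM (fun t => M t - N t) := fun i j => (hM i j).sub (hN i j)

lemma SM.neg {n m : Type*} {M : ℝ → Matrix n m ℝ}
    (hM : SM M) : SM (fun t => - M t) := fun i j => (hM i j).neg

lemma SM.transpose {n m : Type*} {M : ℝ → Matrix n m ℝ}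
    (hM : SM M) : SM (fun t => (M t)ᵀ) := fun i j => hM j i

lemma SM.const {n m : Type*} (M : Matrix n m ℝ) : SM (fun _ => M) := fun _ _ => contDiff_const

lemma SM.smul {n m : Type*} {e : ℝ → ℝ} {M : ℝ → Matrix n m ℝ} (he : ContDiff ℝ (⊤ : ℕ∞) e)
    (hM : SM M) : SM (fun t => e t • M t) := fun i j => he.mul (hM i j)

lemma SM.fromBlocks {n m l o : Type*} {A : ℝ → Matrix n l ℝ} {B : ℝ → Matrix n m ℝ}
    {C : ℝ → Matrix o l ℝ} {D : ℝ → Matrix o m ℝ} (hA : SM A) (hB : SM B) (hC : SM C)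
    (hD : SM D) : SM (fun t => Matrix.fromBlocks (A t) (B t) (C t) (D t)) := by
  rintro (i | i) (j | j)
  · exact hA i j
  · exact hB i j
  · exact hC i j
  · exact hD i j

lemma SM.det {n : Type*} [Fintype n] [DecidableEq n] {M : ℝ → Matrix n n ℝ}
    (hM : SM M) : ContDiff ℝ (⊤ : ℕ∞) fun t => (M t).det := by
  simp only [Matrix.det_apply']
  exact ContDiff.sum fun k _ => contDiff_const.mul (contDiff_prod fun i _ => hM _ _)

lemma SM.adjugate {n : Type*} [Fintype n] [DecidableEq n] {M : ℝ → Matrix n n ℝ}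
    (hM : SM M) : SM fun t => (M t).adjugate := fun i j => by
  simp only [Matrix.adjugate_apply]
  refine SM.det fun k l => ?_
  by_cases hk : k = j
  · subst hk
    simp only [Matrix.updateRow_self]
    exact contDiff_const
  · simp only [Matrix.updateRow_ne hk]
    exact hM k l

lemma exists_smooth_inv {d : ℝ → ℝ} (hd : ContDiff ℝ (⊤ : ℕ∞) d) (h0 : d 0 ≠ 0) :
    ∃ e : ℝ → ℝ, ContDiff ℝ (⊤ : ℕ∞) e ∧ ∀ᶠ t in 𝓝 0, d t * e t = 1 := by
  obtain ⟨ε, hε, hb⟩ := Metric.eventually_nhds_iff_ball.1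
    (hd.continuous.continuousAt.eventually_ne h0)
  let χ : ContDiffBump (0:ℝ) := ⟨ε / 3, ε / 2, by positivity, by linarith⟩
  refine ⟨fun t => χ t / d t, ?_, ?_⟩
  · rw [contDiff_iff_contDiffAt]
    intro x
    by_cases hx : d x = 0
    · have hxs : x ∉ tsupport χ := by
        rw [χ.tsupport_eq]
        intro hx'
        refine hb x ?_ hx
        have : dist x 0 ≤ ε / 2 := hx'
        exact Metric.mem_ball.2 (by linarith)
      have h1 : (fun t => χ t / d t) =ᶠ[𝓝 x] fun _ => 0 := by
        filter_upwards [notMem_tsupport_iff_eventuallyEq.1 hxs] with t ht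
        simp [ht]
      exact contDiffAt_const.congr_of_eventuallyEq h1
    · exact χ.contDiffAt.div hd.contDiffAt hx
  · filter_upwards [χ.eventuallyEq_one, hd.continuous.continuousAt.eventually_ne h0] with t h1 h2
    rw [h1]; simp [h2]

lemma SM.exists_inv {n : Type*} [Fintype n] [DecidableEq n] {M : ℝ → Matrix n n ℝ}
    (hM : SM M) (h0 : IsUnit (M 0)) :
    ∃ N : ℝ → Matrix n n ℝ, SM N ∧ ∀ᶠ t in 𝓝 0, M t * N t = 1 := by
  obtain ⟨e, he, he1⟩ := exists_smooth_inv hM.det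
    (((Matrix.isUnit_iff_isUnit_det _).1 h0).ne_zero)
  refine ⟨fun t => e t • (M t).adjugate, SM.smul he hM.adjugate, ?_⟩
  filter_upwards [he1] with t ht
  rw [Matrix.mul_smul, Matrix.mul_adjugate, smul_smul, mul_comm, ht, one_smul]

lemma exists_inverse_expansion (p m : ℕ)
    (B : ℝ → Matrix (Fin p) (Fin p) ℝ) (E : ℝ → Matrix (Fin p) (Fin m) ℝ)
    (F : ℝ → Matrix (Fin m) (Fin m) ℝ) (hB : SM B) (hE : SM E) (hF : SM F) (hF0 : IsUnit (F 0)) :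
    ∃ N : ℝ → Matrix (Fin p ⊕ Fin m) (Fin p ⊕ Fin m) ℝ, SM N ∧ ∀ᶠ t in 𝓝 (0:ℝ), t ≠ 0 →
      (Matrix.fromBlocks (t ^ 2 • (1 : Matrix (Fin p) (Fin p) ℝ) + t ^ 4 • B t)
        (t ^ 2 • E t) (t ^ 2 • E t)ᵀ (F t))⁻¹ =
      Matrix.fromBlocks ((t ^ 2)⁻¹ • 1) 0 0 0 + N t := by
  obtain ⟨G, hG, hFG⟩ := hF.exists_inv hF0
  set M : ℝ → Matrix (Fin p) (Fin p) ℝ := fun t => B t - E t * G t * (E t)ᵀ with hMdef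
  have hM : SM M := hB.sub ((hE.mul hG).mul hE.transpose)
  have hsq : ContDiff ℝ (⊤ : ℕ∞) fun t : ℝ => t ^ 2 := contDiff_id.pow 2
  have hV1 : SM (fun t : ℝ => 1 + t ^ 2 • M t) := (SM.const 1).add (SM.smul hsq hM)
  obtain ⟨V, hV, hMV⟩ := hV1.exists_inv (by simp)
  refine ⟨fun t => Matrix.fromBlocks (-(M t * V t)) (-(V t * E t * G t))
    (-(G t * (E t)ᵀ * V t)) (G t + t ^ 2 • (G t * (E t)ᵀ * V t * E t * G t)),
    SM.fromBlocks (hM.mul hV).neg ((hV.mul hE).mul hG).neg ((hG.mul hE.transpose).mul hV).neg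
      (hG.add (SM.smul hsq ((((hG.mul hE.transpose).mul hV).mul hE).mul hG))), ?_⟩
  filter_upwards [hFG, hMV] with t h1 h2 ht
  apply Matrix.inv_eq_right_inv
  have hVt : (t ^ 2)⁻¹ • (1 : Matrix (Fin p) (Fin p) ℝ) + -(M t * V t) = (t ^ 2)⁻¹ • V t := by
    have : V t = 1 - t ^ 2 • (M t * V t) := by
      rw [← h2, add_mul, one_mul, Matrix.smul_mul]; simp
    conv_rhs => rw [this]
    rw [smul_sub, smul_smul, inv_mul_cancel₀ (pow_ne_zero 2 ht), one_smul, sub_eq_add_neg]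
  rw [Matrix.fromBlocks_add, hVt, Matrix.fromBlocks_multiply, ← Matrix.fromBlocks_one]
  have hBM : B t = M t + E t * G t * (E t)ᵀ := by simp [hMdef]
  have h2' : V t + t ^ 2 • (M t * V t) = 1 := by
    rw [← h2, add_mul, one_mul, Matrix.smul_mul]
  have ht2 : t ^ 2 ≠ 0 := pow_ne_zero 2 ht
  have h11 : (t ^ 2 • (1 : Matrix (Fin p) (Fin p) ℝ) + t ^ 4 • B t) * ((t ^ 2)⁻¹ • V t)
      = 1 + t ^ 2 • (E t * G t * (E t)ᵀ * V t) := by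
    rw [hBM, Matrix.mul_smul, add_mul, Matrix.smul_mul, Matrix.smul_mul, one_mul, add_mul,
      smul_add, smul_smul, smul_smul, inv_mul_cancel₀ ht2, one_smul,
      show (t ^ 2)⁻¹ * t ^ 4 = t ^ 2 by field_simp, smul_add, ← add_assoc, h2']
  have h12 : (t ^ 2 • (1 : Matrix (Fin p) (Fin p) ℝ) + t ^ 4 • B t) * V t
      = t ^ 2 • (1 + t ^ 2 • (E t * G t * (E t)ᵀ * V t)) := by
    rw [← h11, Matrix.mul_smul, smul_smul, mul_inv_cancel₀ ht2, one_smul]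
  congr 1
  · rw [h11]
    simp only [zero_add, Matrix.smul_mul, Matrix.mul_neg, Matrix.mul_assoc]
    abel
  · simp only [zero_add, Matrix.mul_neg]
    rw [← Matrix.mul_assoc, ← Matrix.mul_assoc, h12]
    simp only [Matrix.smul_mul, Matrix.add_mul, Matrix.mul_add, Matrix.mul_smul, smul_add,
      Matrix.one_mul, Matrix.mul_assoc]
    abel
  · simp only [zero_add, Matrix.mul_neg, Matrix.mul_smul, Matrix.transpose_smul, Matrix.smul_mul,
      smul_smul, inv_mul_cancel₀ ht2, one_smul]
    rw [← Matrix.mul_assoc, ← Matrix.mul_assoc, h1, Matrix.one_mul, add_neg_cancel]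
  · simp only [zero_add, Matrix.mul_neg, Matrix.mul_smul, Matrix.transpose_smul, Matrix.smul_mul,
      Matrix.mul_add, h1]
    simp only [← Matrix.mul_assoc, h1, Matrix.one_mul]
    abel

lemma SM.matDeriv {n m : Type*} {M : ℝ → Matrix n m ℝ} (hM : SM M) : SM (matDeriv M) :=
  fun i j => (contDiff_infty_iff_deriv.1 (hM i j)).2

lemma trace_formula (p m : ℕ) (B : ℝ → Matrix (Fin p) (Fin p) ℝ) (hB : SM B)
    (P : ℝ → Matrix (Fin p ⊕ Fin m) (Fin p ⊕ Fin m) ℝ) (hP : SM P)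
    (hPB : ∀ t i j, P t (Sum.inl i) (Sum.inl j) =
      (t ^ 2 • (1 : Matrix (Fin p) (Fin p) ℝ) + t ^ 4 • B t) i j)
    (N : ℝ → Matrix (Fin p ⊕ Fin m) (Fin p ⊕ Fin m) ℝ) (hN : SM N)
    (hinv : ∀ᶠ t in 𝓝 (0:ℝ), t ≠ 0 →
      (P t)⁻¹ = Matrix.fromBlocks ((t ^ 2)⁻¹ • 1) 0 0 0 + N t) :
    ∃ (b : ℝ → ℝ) (c : ℝ × ℝ → ℝ), ContDiff ℝ (⊤ : ℕ∞) b ∧ ContDiff ℝ (⊤ : ℕ∞) c ∧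
      ∀ᶠ t in 𝓝 (0:ℝ), t ≠ 0 → ∀ s, (1 / 2) * Matrix.trace ((P t)⁻¹ * matDeriv P s) =
        p * s / t ^ 2 + s ^ 3 / t ^ 2 * b s + c (t, s) := by
  have hB' := hB.matDeriv
  have hP' := hP.matDeriv
  refine ⟨fun s => (1 / 2) * ∑ i, (4 * B s i i + s * matDeriv B s i i),
    fun x => (1 / 2) * Matrix.trace (N x.1 * matDeriv P x.2), ?_, ?_, ?_⟩
  · refine contDiff_const.mul (ContDiff.sum fun i _ => ?_)
    exact (contDiff_const.mul (hB i i)).add (contDiff_id.mul (hB' i i))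
  · refine contDiff_const.mul ?_
    simp only [Matrix.trace, Matrix.diag, Matrix.mul_apply]
    refine ContDiff.sum fun i _ => ContDiff.sum fun j _ => ?_
    exact ((hN i j).comp contDiff_fst).mul ((hP' j i).comp contDiff_snd)
  · filter_upwards [hinv] with t ht ht0 s
    rw [ht ht0, Matrix.add_mul, Matrix.trace_add, mul_add]
    congr 1
    have hd : ∀ i, matDeriv P s (Sum.inl i) (Sum.inl i) =
        2 * s + s ^ 3 * (4 * B s i i + s * matDeriv B s i i) := by
      intro i
      have h1 : (fun x => P x (Sum.inl i) (Sum.inl i)) = fun x => x ^ 2 + x ^ 4 * B x i i := by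
        funext x; simp [hPB]
      have h2 : HasDerivAt (fun x => B x i i) (matDeriv B s i i) s :=
        (((hB i i).differentiable (by simp)) s).hasDerivAt
      have h3 := (hasDerivAt_pow 2 s).add ((hasDerivAt_pow 4 s).mul h2)
      change deriv (fun x => P x (Sum.inl i) (Sum.inl i)) s = _
      rw [h1]
      refine h3.deriv.trans ?_
      push_cast
      ring
    have htr : Matrix.trace (Matrix.fromBlocks ((t ^ 2)⁻¹ • (1 : Matrix (Fin p) (Fin p) ℝ)) 0 0
        (0 : Matrix (Fin m) (Fin m) ℝ) * matDeriv P s)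
        = ∑ i : Fin p, (t ^ 2)⁻¹ * matDeriv P s (Sum.inl i) (Sum.inl i) := by
      simp [Matrix.trace, Matrix.mul_apply, Matrix.one_apply]
    rw [htr]
    simp only [hd, ← Finset.mul_sum, Finset.sum_add_distrib]
    simp
    field_simp

/-- Local facts about a harmonic solution in the desingularised variables. -/
lemma solution_facts {p m : ℕ} {P : ℝ → Matrix (Fin p ⊕ Fin m) (Fin p ⊕ Fin m) ℝ}
    {b : ℝ → ℝ} {c : ℝ × ℝ → ℝ}
    (hbc : ∀ᶠ t in 𝓝 (0:ℝ), t ≠ 0 → ∀ s, (1 / 2) * Matrix.trace ((P t)⁻¹ * matDeriv P s) =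
        p * s / t ^ 2 + s ^ 3 / t ^ 2 * b s + c (t, s))
    {v ε : ℝ} (hε : 0 < ε) {r : ℝ → ℝ} (hr : IsHarmonicSolution P v ε r) :
    (∀ᶠ t in 𝓝[>] 0, HasDerivAt (fun t => r t / t) ((deriv r t - r t / t) / t) t) ∧
    (∀ᶠ t in 𝓝[>] 0, HasDerivAt (fun t => deriv r t - r t / t)
      (-(p + 1) * (deriv r t - r t / t) / t +
        (-(r t / t + (deriv r t - r t / t)) * (t * b t + c (t, t))
          + t * (r t / t) ^ 3 * b (t * (r t / t)) + c (t, t * (r t / t)))) t) ∧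
    Tendsto (fun t => r t / t) (𝓝[>] 0) (𝓝 v) ∧
    ∃ K, ∀ᶠ t in 𝓝[>] 0, |deriv r t - r t / t| ≤ K * t := by
  obtain ⟨hs, h0, hv, hode⟩ := hr
  have hIoo : Ioo 0 ε ∈ 𝓝[>] (0:ℝ) := Ioo_mem_nhdsGT hε
  have hoo : ContDiffOn ℝ (⊤ : ℕ∞) r (Ioo 0 ε) := hs.mono Ioo_subset_Ico_self
  have hd1 : ∀ t ∈ Ioo 0 ε, HasDerivAt r (deriv r t) t := fun t ht =>
    ((hoo.contDiffAt (isOpen_Ioo.mem_nhds ht)).differentiableAt (by simp)).hasDerivAt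
  have hoo' : ContDiffOn ℝ (⊤ : ℕ∞) (deriv r) (Ioo 0 ε) :=
    ((contDiffOn_infty_iff_deriv_of_isOpen isOpen_Ioo).1 hoo).2
  have hd2 : ∀ t ∈ Ioo 0 ε, HasDerivAt (deriv r) (deriv (deriv r) t) t := fun t ht =>
    ((hoo'.contDiffAt (isOpen_Ioo.mem_nhds ht)).differentiableAt (by simp)).hasDerivAt
  have h0mem : (0:ℝ) ∈ Ico 0 ε := ⟨le_rfl, hε⟩
  have hdu : ∀ t ∈ Ioo 0 ε, HasDerivAt (fun t => r t / t) ((deriv r t - r t / t) / t) t := by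
    intro t ht
    have ht0 := ht.1.ne'
    refine ((hd1 t ht).div (hasDerivAt_id t) ht0).congr_deriv ?_
    simp only [id]
    field_simp
  have hr0 : HasDerivWithinAt r v (Ico 0 ε) 0 := by
    rw [← hv]
    exact ((hs.differentiableOn (by simp)) 0 h0mem).hasDerivWithinAt
  have hle : 𝓝[>] (0:ℝ) ≤ 𝓝[Ico 0 ε] 0 := by
    rw [← nhdsWithin_Ioo_eq_nhdsGT hε]
    exact nhdsWithin_mono _ Ioo_subset_Ico_self
  refine ⟨?_, ?_, ?_, ?_⟩
  · filter_upwards [hIoo] with t ht using hdu t ht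
  · filter_upwards [hIoo, hbc.filter_mono nhdsWithin_le_nhds] with t ht hb
    have ht0 := ht.1.ne'
    refine ((hd2 t ht).sub (hdu t ht)).congr_deriv ?_
    have e := hode t ht
    have e1 := hb ht0 t
    have e2 := hb ht0 (r t)
    have e3 : deriv (deriv r) t = - (deriv r t * (p * t / t ^ 2 + t ^ 3 / t ^ 2 * b t + c (t, t)))
        + (p * r t / t ^ 2 + r t ^ 3 / t ^ 2 * b (r t) + c (t, r t)) := by
      rw [← e1, ← e2]; linarith
    rw [e3, show t * (r t / t) = r t by field_simp]
    field_simp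
    ring
  · have := (hasDerivWithinAt_iff_tendsto_slope.1 hr0)
    have h2 : 𝓝[>] (0:ℝ) ≤ 𝓝[Ico 0 ε \ {0}] 0 := by
      rw [← nhdsWithin_Ioo_eq_nhdsGT hε]
      exact nhdsWithin_mono _ fun x hx => ⟨Ioo_subset_Ico_self hx, hx.1.ne'⟩
    refine (this.mono_left h2).congr fun t => ?_
    simp [slope_def_field, h0]
  · set r1 : ℝ → ℝ := derivWithin r (Ico 0 ε) with hr1
    have hr1s : ContDiffOn ℝ (⊤ : ℕ∞) r1 (Ico 0 ε) :=
      ((contDiffOn_infty_iff_derivWithin (uniqueDiffOn_Ico 0 ε)).1 hs).2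
    have hr1d := (hr1s.differentiableOn (by simp)) 0 h0mem
    obtain ⟨K, hK⟩ := (hr1d.isBigO_sub.mono hle).bound
    have hK' : ∀ᶠ t in 𝓝[>] (0:ℝ), |deriv r t - v| ≤ |K| * t := by
      filter_upwards [hK, hIoo] with t ht hI
      have e1 : r1 t = deriv r t :=
        derivWithin_of_mem_nhds (Ico_mem_nhds hI.1 hI.2)
      rw [e1, hv, Real.norm_eq_abs, sub_zero, Real.norm_of_nonneg hI.1.le] at ht
      exact ht.trans (mul_le_mul_of_nonneg_right (le_abs_self K) hI.1.le)
    obtain ⟨a, ha, hKa⟩ := mem_nhdsGT_iff_exists_Ioo_subset.1 hK'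
    have ha : 0 < a := ha
    refine ⟨2 * |K|, ?_⟩
    filter_upwards [Ioo_mem_nhdsGT (lt_min ha hε)] with t ht
    have hta : t < a := ht.2.trans_le (min_le_left _ _)
    have htε : t < ε := ht.2.trans_le (min_le_right _ _)
    have hm : |r t - v * t| ≤ (|K| * t) * t := by
      refine mvt_zero (f := fun t => r t - v * t) (f' := fun t => deriv r t - v) ht.1 ?_ ?_ ?_
      · intro s hs'
        refine ((hd1 s ⟨hs'.1, hs'.2.trans_lt htε⟩).sub ((hasDerivAt_id s).const_mul v)).congr_deriv ?_
        simp
      · intro s hs'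
        have : |deriv r s - v| ≤ |K| * s := hKa ⟨hs'.1, hs'.2.trans_lt hta⟩
        exact this.trans (mul_le_mul_of_nonneg_left hs'.2 (abs_nonneg _))
      · have h1 : Tendsto r (𝓝[>] 0) (𝓝 (r 0)) := hr0.continuousWithinAt.tendsto.mono_left hle
        have h2 : Tendsto (fun t : ℝ => v * t) (𝓝[>] 0) (𝓝 (v * 0)) :=
          Tendsto.const_mul v nhdsWithin_le_nhds
        simpa [h0] using h1.sub h2
    have h1 : |deriv r t - v| ≤ |K| * t := hKa ⟨ht.1, hta⟩
    have h2 : |r t / t - v| ≤ |K| * t := by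
      have e : r t / t - v = (r t - v * t) / t := by
        have := ht.1.ne'
        field_simp
      rw [e, abs_div, abs_of_pos ht.1, div_le_iff₀ ht.1]
      exact hm
    calc |deriv r t - r t / t| = |(deriv r t - v) - (r t / t - v)| := by congr 1; ring
      _ ≤ |deriv r t - v| + |r t / t - v| := abs_sub _ _
      _ ≤ 2 * |K| * t := by linarith

theorem harmonic_map_ivp_at_singular_orbit
    (p m : ℕ) (hp : 1 ≤ p) (hm : 1 ≤ m)
    (A : ℝ → Matrix (Fin m) (Fin m) ℝ) (B : ℝ → Matrix (Fin p) (Fin p) ℝ)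
    (C : ℝ → Matrix (Fin p) (Fin m) ℝ)
    (A₀ A₁ : Matrix (Fin m) (Fin m) ℝ) (C₀ : Matrix (Fin p) (Fin m) ℝ)
    (hA : ∀ i j, ContDiff ℝ (⊤ : ℕ∞) fun t => A t i j)
    (hB : ∀ i j, ContDiff ℝ (⊤ : ℕ∞) fun t => B t i j)
    (hC : ∀ i j, ContDiff ℝ (⊤ : ℕ∞) fun t => C t i j)
    (hA₀ : IsUnit A₀)
    (P : ℝ → Matrix (Fin p ⊕ Fin m) (Fin p ⊕ Fin m) ℝ)
    (hP : ∀ t : ℝ, P t = Matrix.fromBlocks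
      (t ^ 2 • (1 : Matrix (Fin p) (Fin p) ℝ) + t ^ 4 • B t)
      (t ^ 2 • C₀ + t ^ 3 • C t)
      (t ^ 2 • C₀ + t ^ 3 • C t)ᵀ
      (A₀ + t • A₁ + t ^ 2 • A t))
    (hsym : ∀ t : ℝ, (P t).IsSymm)
    (hinvP : ∃ δ₀ > (0 : ℝ), ∀ t : ℝ, t ≠ 0 → |t| < δ₀ → IsUnit (P t))
    (v : ℝ) :
    (∃ ε > 0, ∃ r : ℝ → ℝ, IsHarmonicSolution P v ε r) ∧
    (∀ ε₁ ε₂ : ℝ, 0 < ε₁ → 0 < ε₂ → ∀ r₁ r₂ : ℝ → ℝ,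
      IsHarmonicSolution P v ε₁ r₁ → IsHarmonicSolution P v ε₂ r₂ →
      ∃ δ > 0, Set.EqOn r₁ r₂ (Set.Ico 0 δ)) := by
  have hE : SM (fun t => C₀ + t • C t) := (SM.const C₀).add (SM.smul contDiff_id hC)
  have hF : SM (fun t => A₀ + t • A₁ + t ^ 2 • A t) :=
    ((SM.const A₀).add (SM.smul contDiff_id (SM.const A₁))).add (SM.smul (contDiff_id.pow 2) hA)
  have hPE : ∀ t, P t = Matrix.fromBlocks (t ^ 2 • (1 : Matrix (Fin p) (Fin p) ℝ) + t ^ 4 • B t)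
      (t ^ 2 • (C₀ + t • C t)) (t ^ 2 • (C₀ + t • C t))ᵀ (A₀ + t • A₁ + t ^ 2 • A t) := by
    intro t
    rw [hP t, smul_add, smul_smul, ← pow_succ]
  obtain ⟨N, hN, hinv⟩ := exists_inverse_expansion p m B _ _ hB hE hF (by simpa using hA₀)
  have hPs : SM P := by
    have h1 := (SM.smul (contDiff_id.pow 2) (SM.const (1 : Matrix (Fin p) (Fin p) ℝ))).add
      (SM.smul (contDiff_id.pow 4) hB)
    have h2 := SM.smul (contDiff_id.pow 2) hE
    have h3 := SM.fromBlocks h1 h2 h2.transpose hF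
    rw [funext hPE]
    exact h3
  obtain ⟨b, c, hb, hc, hbc⟩ := trace_formula p m B hB P hPs
    (fun t i j => by rw [hPE t]; rfl) N hN (by
      filter_upwards [hinv] with t ht ht0
      rw [hPE t]; exact ht ht0)
  have hh : ContDiff ℝ (⊤ : ℕ∞) (fun x : ℝ × ℝ × ℝ =>
      -(x.2.1 + x.2.2) * (x.1 * b x.1 + c (x.1, x.1))
        + x.1 * x.2.1 ^ 3 * b (x.1 * x.2.1) + c (x.1, x.1 * x.2.1)) := by
    fun_prop
  constructor
  · obtain ⟨u, z, hu, hz, h0, hud, hw⟩ := local_existence (p + 1) v _ hh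
    obtain ⟨ε, hε, hball⟩ := Metric.eventually_nhds_iff.1 (hw.and hbc)
    have hr1 : ∀ t, HasDerivAt (fun t => t * u t) (u t + t * z t) t := fun t => by
      refine ((hasDerivAt_id t).mul (hud t)).congr_deriv ?_
      simp
    have hder : deriv (fun t => t * u t) = fun t => u t + t * z t := funext fun t => (hr1 t).deriv
    refine ⟨ε, hε, fun t => t * u t, (contDiff_id.mul hu).contDiffOn, by simp, ?_, ?_⟩
    · rw [(hr1 0).hasDerivWithinAt.derivWithin (uniqueDiffOn_Ico 0 ε 0 ⟨le_rfl, hε⟩)]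
      simp [h0]
    · intro t ht
      have ht0 : t ≠ 0 := ht.1.ne'
      obtain ⟨hw1, hb1⟩ := hball (y := t) (by rw [Real.dist_eq, sub_zero, abs_of_pos ht.1]; exact ht.2)
      have e1 := hb1 ht0 t
      have e2 := hb1 ht0 (t * u t)
      have e0 := ((hud t).add hw1).deriv
      rw [hder]
      change deriv (fun t => u t + t * z t) t + 1 / 2 * (u t + t * z t) * _
        - 1 / 2 * Matrix.trace ((P t)⁻¹ * matDeriv P (t * u t)) = 0
      change deriv (fun t => u t + t * z t) t = _ at e0
      rw [e0, e2,
        show (1 / 2) * (u t + t * z t) * Matrix.trace ((P t)⁻¹ * matDeriv P t)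
          = (u t + t * z t) * ((1 / 2) * Matrix.trace ((P t)⁻¹ * matDeriv P t)) by ring, e1]
      push_cast
      field_simp
      ring
  · intro ε₁ ε₂ hε₁ hε₂ r₁ r₂ hr₁ hr₂
    obtain ⟨a1, a2, a3, K1, a4⟩ := solution_facts hbc hε₁ hr₁
    obtain ⟨b1, b2, b3, K2, b4⟩ := solution_facts hbc hε₂ hr₂
    have hpos : ∀ᶠ t in 𝓝[>] (0:ℝ), 0 < t := self_mem_nhdsWithin
    obtain ⟨δ, hδ, hEq⟩ := local_uniqueness p v _ hh
      ![fun t => r₁ t / t, fun t => r₂ t / t]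
      ![fun t => deriv r₁ t - r₁ t / t, fun t => deriv r₂ t - r₂ t / t] (max K1 K2)
      (Fin.forall_fin_two.2 ⟨a1, b1⟩) (Fin.forall_fin_two.2 ⟨a2, b2⟩)
      (Fin.forall_fin_two.2 ⟨a3, b3⟩) (Fin.forall_fin_two.2 ⟨by
        filter_upwards [a4, hpos] with t h1 h2
        exact h1.trans (mul_le_mul_of_nonneg_right (le_max_left _ _) h2.le), by
        filter_upwards [b4, hpos] with t h1 h2
        exact h1.trans (mul_le_mul_of_nonneg_right (le_max_right _ _) h2.le)⟩)
    refine ⟨δ, hδ, fun t ht => ?_⟩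
    rcases eq_or_lt_of_le ht.1 with h | h
    · rw [← h, hr₁.2.1, hr₂.2.1]
    · have e : r₁ t / t = r₂ t / t := hEq t ⟨h, ht.2⟩
      exact (div_left_inj' h.ne').1 e
end

section
/- Let h : {s ∈ ℂ : |s| < ρ} → ℂⁿ be holomorphic and let Ŷ₀ ∈ ℂⁿ. Define Ŷ : H → ℂⁿ by Ŷ(z) := Û(z)·(Ŷ₀ + ∫₀¹ (z − z₀)·exp(γ(τ))·Û(γ(τ))⁻¹·h(exp(γ(τ))) dτ), where γ(τ) := z₀ + τ·(z − z₀) is the straight segment from z₀ to z (which lies in H since H is a half-plane). Then Ŷ is the solution of the inhomogeneous pulled-back regular-singular system: Ŷ(z₀) = Ŷ₀ and Ŷ'(z) + A(exp z)·Ŷ(z) = exp(z)·h(exp z) for all z ∈ H. -/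
open Set Matrix Complex

/-- `U` is the fundamental solution, on the half-plane `H = {Re z < log ρ}`, of the
homogeneous linear regular-singular system pulled back under `s = exp z`:
`U(z₀) = 1`, `U(z)` is invertible, and `U'(z) = −A(exp z)·U(z)` (entrywise). -/
def IsFundamentalSolution (n : ℕ) (ρ : ℝ) (A : ℂ → Matrix (Fin n) (Fin n) ℂ)
    (z₀ : ℂ) (U : ℂ → Matrix (Fin n) (Fin n) ℂ) : Prop :=
  U z₀ = 1 ∧ (∀ z : ℂ, z.re < Real.log ρ → IsUnit (U z)) ∧
    (∀ z : ℂ, z.re < Real.log ρ → ∀ i j,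
      HasDerivAt (fun w => U w i j) ((-(A (Complex.exp z) * U z)) i j) z)

theorem aux_det {n : ℕ} (M : ℂ → Matrix (Fin n) (Fin n) ℂ) (z : ℂ)
    (hM : ∀ i j, DifferentiableAt ℂ (fun w => M w i j) z) :
    DifferentiableAt ℂ (fun w => (M w).det) z := by
  simp only [Matrix.det_apply]
  refine DifferentiableAt.fun_sum fun σ _ => ?_
  refine DifferentiableAt.fun_const_smul ?_ _
  exact DifferentiableAt.fun_finsetProd fun i _ => hM _ _

theorem aux_inv {n : ℕ} (M : ℂ → Matrix (Fin n) (Fin n) ℂ) (z : ℂ)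
    (hM : ∀ i j, DifferentiableAt ℂ (fun w => M w i j) z) (hu : IsUnit (M z)) (i j : Fin n) :
    DifferentiableAt ℂ (fun w => (M w)⁻¹ i j) z := by
  have hd : (M z).det ≠ 0 := by
    have := (Matrix.isUnit_iff_isUnit_det _).1 hu
    exact this.ne_zero
  simp only [Matrix.inv_def, Matrix.smul_apply, Ring.inverse_eq_inv', smul_eq_mul,
    Matrix.adjugate_apply]
  refine ((aux_det M z hM).inv hd).mul (aux_det _ z ?_)
  intro k l
  by_cases hk : k = j
  · subst hk
    simp
  · simpa [Matrix.updateRow_ne hk] using hM k l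

theorem inhomogeneous_solution_formula
    (n : ℕ) (hn : 1 ≤ n) (ρ : ℝ) (hρ : 0 < ρ)
    (A : ℂ → Matrix (Fin n) (Fin n) ℂ)
    (hA : ∀ i j, DifferentiableOn ℂ (fun s => A s i j) (Metric.ball (0 : ℂ) ρ))
    (z₀ : ℂ) (hz₀ : z₀.re < Real.log ρ)
    (U : ℂ → Matrix (Fin n) (Fin n) ℂ)
    (hU : IsFundamentalSolution n ρ A z₀ U)
    (h : ℂ → (Fin n → ℂ))
    (hh : ∀ i, DifferentiableOn ℂ (fun s => h s i) (Metric.ball (0 : ℂ) ρ))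
    (Y₀ : Fin n → ℂ)
    (Y : ℂ → (Fin n → ℂ))
    (hY : ∀ z : ℂ, Y z = (U z).mulVec (Y₀ +
      ∫ τ in (0:ℝ)..1,
        (((z - z₀) * Complex.exp (z₀ + (τ : ℂ) * (z - z₀))) •
          (U (z₀ + (τ : ℂ) * (z - z₀)))⁻¹.mulVec
            (h (Complex.exp (z₀ + (τ : ℂ) * (z - z₀))))))) :
    Y z₀ = Y₀ ∧
    ∀ z : ℂ, z.re < Real.log ρ →
      HasDerivAt Y (Complex.exp z • h (Complex.exp z) - (A (Complex.exp z)).mulVec (Y z)) z := by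
  obtain ⟨hU0, hUu, hUd⟩ := hU
  refine ⟨by rw [hY, hU0]; simp, ?_⟩
  set H : Set ℂ := {z | z.re < Real.log ρ} with hH
  have hHo : IsOpen H := isOpen_lt Complex.continuous_re continuous_const
  have hHc : Convex ℝ H := convex_halfSpace_re_lt _
  have hexp : ∀ z ∈ H, Complex.exp z ∈ Metric.ball (0 : ℂ) ρ := by
    intro z hz
    rw [mem_ball_zero_iff, Complex.norm_exp]
    exact (Real.lt_log_iff_exp_lt hρ).1 hz
  set F : ℂ → Fin n → ℂ := fun z => Complex.exp z • (U z)⁻¹.mulVec (h (Complex.exp z)) with hF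
  have hFd : DifferentiableOn ℂ F H := by
    intro z hz
    refine DifferentiableAt.differentiableWithinAt ?_
    refine Complex.differentiableAt_exp.smul (differentiableAt_pi.2 fun i => ?_)
    simp only [Matrix.mulVec, dotProduct]
    refine DifferentiableAt.fun_sum fun j _ => ?_
    refine (aux_inv U z (fun i j => (hUd z hz i j).differentiableAt) (hUu z hz) i j).mul ?_
    exact DifferentiableAt.comp z
      ((hh j).differentiableAt (Metric.isOpen_ball.mem_nhds (hexp z hz)))
      Complex.differentiableAt_exp
  obtain ⟨g, hg⟩ := hHc.exists_forall_hasDerivWithinAt hFd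
  have hg' : ∀ z ∈ H, HasDerivAt g (F z) z := fun z hz => (hg z hz).hasDerivAt (hHo.mem_nhds hz)
  have hint : ∀ z ∈ H, Y z = (U z).mulVec (Y₀ + (g z - g z₀)) := by
    intro z hz
    rw [hY]
    congr 2
    have hseg : ∀ τ ∈ Set.uIcc (0:ℝ) 1, z₀ + (τ : ℂ) * (z - z₀) ∈ H := by
      intro τ hτ
      rw [Set.uIcc_of_le zero_le_one] at hτ
      have := hHc.add_smul_sub_mem (x := z₀) (y := z) hz₀ hz hτ
      simpa using this
    have hline : ∀ τ : ℝ, HasDerivAt (fun t : ℝ => z₀ + (t : ℂ) * (z - z₀)) (z - z₀) τ := by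
      intro τ
      simpa using ((Complex.ofRealCLM.hasDerivAt (x := τ)).mul_const (z - z₀)).const_add z₀
    have key := intervalIntegral.integral_eq_sub_of_hasDerivAt (a := 0) (b := 1)
      (f := fun t : ℝ => g (z₀ + (t : ℂ) * (z - z₀)))
      (f' := fun t : ℝ => (z - z₀) • F (z₀ + (t : ℂ) * (z - z₀)))
      (fun τ hτ => HasDerivAt.scomp τ (hg' _ (hseg τ hτ)) (hline τ))
      (ContinuousOn.intervalIntegrable (ContinuousOn.fun_const_smul
        (hFd.continuousOn.comp (by fun_prop) hseg) (z - z₀)))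
    simpa [hF, smul_smul] using key
  intro z hz
  have hev : Y =ᶠ[nhds z] fun z => (U z).mulVec (Y₀ + (g z - g z₀)) :=
    Filter.eventually_of_mem (hHo.mem_nhds hz) hint
  refine HasDerivAt.congr_of_eventuallyEq ?_ hev
  rw [hasDerivAt_pi]
  intro i
  have hgi : ∀ j, HasDerivAt (fun w => (Y₀ + (g w - g z₀)) j) (F z j) z := by
    intro j
    have := (((hasDerivAt_pi.1 (hg' z hz)) j).sub_const (g z₀ j)).const_add (Y₀ j)
    simpa using this
  have hsum := HasDerivAt.fun_sum (u := Finset.univ)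
    fun j _ => (hUd z hz i j).mul (hgi j)
  refine hsum.congr_deriv ?_
  rw [Finset.sum_add_distrib]
  have e1 : ∑ j, (-(A (Complex.exp z) * U z)) i j * (Y₀ + (g z - g z₀)) j
      = -((A (Complex.exp z)).mulVec (Y z)) i := by
    rw [hint z hz, Matrix.mulVec_mulVec]
    simp only [Matrix.mulVec, dotProduct, Matrix.neg_apply, neg_mul, Finset.sum_neg_distrib]
  have e2 : ∑ j, U z i j * F z j = (Complex.exp z • h (Complex.exp z)) i := by
    have : (U z).mulVec (F z) = Complex.exp z • h (Complex.exp z) := by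
      rw [hF]
      simp only
      rw [Matrix.mulVec_smul, Matrix.mulVec_mulVec,
        Matrix.mul_nonsing_inv _ ((Matrix.isUnit_iff_isUnit_det _).1 (hUu z hz)),
        Matrix.one_mulVec]
    rw [← this]
    rfl
  rw [e1, e2, Pi.sub_apply]
  ring
end

section
/- Let λ ∈ ℂ and define the 2×2 complex matrices A₀ := [[λ, 0], [0, λ+1]] and A₁ := [[0, 1], [0, 0]], and the map Û : ℂ → Matrix 2 2 ℂ by Û(z) := exp(−λ z)·[[1, −z], [0, exp(−z)]]. Then: (i) Û'(z) + (A₀ + exp(z)·A₁)·Û(z) = 0 for all z ∈ ℂ; (ii) Û(z) is invertible for every z and Û(z + 2πi)·Û(z)⁻¹ = exp(−2πi λ)·[[1, −2πi·exp(z)], [0, 1]] for all z ∈ ℂ, so the monodromy map is M(σ) = exp(−2πi λ)·[[1, −2πi σ], [0, 1]]; and (iii) for every σ ≠ 0 the matrix M(σ) is NOT similar to M(0) = exp(−2πi λ)·I. In particular, the continuously extended monodromy matrix at the singular point need not be conjugate to the monodromy matrices at nearby regular points. -/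
open Set Matrix Complex

theorem monodromy_counterexample
    (lam : ℂ)
    (A₀ A₁ : Matrix (Fin 2) (Fin 2) ℂ)
    (hA₀ : A₀ = !![lam, 0; 0, lam + 1])
    (hA₁ : A₁ = !![0, 1; 0, 0])
    (U : ℂ → Matrix (Fin 2) (Fin 2) ℂ)
    (hU : ∀ z : ℂ, U z = Complex.exp (-(lam * z)) • !![1, -z; 0, Complex.exp (-z)])
    (M : ℂ → Matrix (Fin 2) (Fin 2) ℂ)
    (hM : ∀ σ : ℂ, M σ = Complex.exp (-(2 * Real.pi * Complex.I * lam)) •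
      !![1, -(2 * Real.pi * Complex.I * σ); 0, 1]) :
    (∀ z : ℂ, ∀ i j, HasDerivAt (fun w => U w i j)
      ((-((A₀ + Complex.exp z • A₁) * U z)) i j) z) ∧
    (∀ z : ℂ, IsUnit (U z) ∧
      U (z + 2 * Real.pi * Complex.I) * (U z)⁻¹ = M (Complex.exp z)) ∧
    (M 0 = Complex.exp (-(2 * Real.pi * Complex.I * lam)) • (1 : Matrix (Fin 2) (Fin 2) ℂ)) ∧
    (∀ σ : ℂ, σ ≠ 0 →
      ¬ ∃ g : Matrix (Fin 2) (Fin 2) ℂ, IsUnit g ∧ M σ = g * M 0 * g⁻¹) := by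
  have hdet : ∀ z, IsUnit (U z) := by
    intro z
    rw [Matrix.isUnit_iff_isUnit_det, hU, isUnit_iff_ne_zero]
    simp [Matrix.det_fin_two, Complex.exp_ne_zero]
  have hM0 : M 0 = Complex.exp (-(2 * Real.pi * Complex.I * lam)) •
      (1 : Matrix (Fin 2) (Fin 2) ℂ) := by
    rw [hM, Matrix.one_fin_two]
    simp
  refine ⟨?_, ?_, hM0, ?_⟩
  · intro z i j
    have h1 : HasDerivAt (fun w : ℂ => Complex.exp (-(lam * w)))
        (Complex.exp (-(lam * z)) * (-(lam * 1))) z :=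
      (((hasDerivAt_id z).const_mul lam).neg).cexp
    have h2 : HasDerivAt (fun w : ℂ => Complex.exp (-w)) (Complex.exp (-z) * (-1)) z :=
      ((hasDerivAt_id z).neg).cexp
    have h3 : HasDerivAt (fun w : ℂ => -w) (-1) z := (hasDerivAt_id z).neg
    have he : Complex.exp z * Complex.exp (-z) = 1 := by
      rw [← Complex.exp_add]; simp
    simp only [hU, hA₀, hA₁]
    fin_cases i <;> fin_cases j
    · simp [Matrix.mul_apply, Fin.sum_univ_two]
      convert h1 using 1
      ring
    · have h4 := h1.mul h3
      simp [Matrix.mul_apply, Fin.sum_univ_two]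
      have hf : (fun w : ℂ => -(Complex.exp (-(lam * w)) * w)) =
          (fun w => Complex.exp (-(lam * w))) * fun w => -w := by
        ext w; simp
      rw [hf]
      refine h4.congr_deriv ?_
      linear_combination Complex.exp (-(lam * z)) * he
    · simp [Matrix.mul_apply, Fin.sum_univ_two]
      exact hasDerivAt_const _ _
    · have h4 := h1.mul h2
      simp [Matrix.mul_apply, Fin.sum_univ_two]
      refine h4.congr_deriv ?_
      ring
  · intro z
    refine ⟨hdet z, ?_⟩
    have hd := (Matrix.isUnit_iff_isUnit_det _).1 (hdet z)
    have key : U (z + 2 * Real.pi * Complex.I) = M (Complex.exp z) * U z := by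
      have e1 : Complex.exp (-(lam * (z + 2 * Real.pi * Complex.I))) =
          Complex.exp (-(2 * Real.pi * Complex.I * lam)) * Complex.exp (-(lam * z)) := by
        rw [← Complex.exp_add]; congr 1; ring
      have e2 : Complex.exp (-(z + 2 * Real.pi * Complex.I)) = Complex.exp (-z) := by
        rw [neg_add, ← sub_eq_add_neg, Complex.exp_periodic.sub_eq]
      have he : Complex.exp z * Complex.exp (-z) = 1 := by
        rw [← Complex.exp_add]; simp
      rw [hU, hU, hM, e1, e2, Matrix.smul_mul, Matrix.mul_smul, smul_smul]
      congr 1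
      ext i j
      fin_cases i <;> fin_cases j <;> simp [Matrix.mul_apply, Fin.sum_univ_two]
      linear_combination (2 * Real.pi * Complex.I) * he
    rw [key, Matrix.mul_nonsing_inv_cancel_right _ _ hd]
  · rintro σ hσ ⟨g, hg, h⟩
    have hd := (Matrix.isUnit_iff_isUnit_det _).1 hg
    rw [hM0, Matrix.mul_smul, Matrix.mul_one, Matrix.smul_mul, Matrix.mul_nonsing_inv _ hd,
      hM] at h
    have h01 := congrFun (congrFun h 0) 1
    simp [Complex.exp_ne_zero, Real.pi_ne_zero, hσ] at h01
end

section
/- Let n ≥ 1, let Y : (0, 1] → ℂⁿ be differentiable and bounded, and let h : [0, 1] → ℂⁿ be continuous. If Y'(t) + (1/t)·h(t) = 0 for all t ∈ (0, 1], then h(0) = 0. -/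
open Set Filter

theorem singular_coefficient_vanishes_of_bounded_solution
    (n : ℕ) (hn : 1 ≤ n)
    (Y : ℝ → (Fin n → ℂ)) (h : ℝ → (Fin n → ℂ))
    (hh : ContinuousOn h (Set.Icc (0 : ℝ) 1))
    (hbdd : ∃ C : ℝ, ∀ t ∈ Set.Ioc (0 : ℝ) 1, ‖Y t‖ ≤ C)
    (hY : ∀ t ∈ Set.Ioc (0 : ℝ) 1,
      HasDerivWithinAt Y (-((1 / t) • h t)) (Set.Ioc (0 : ℝ) 1) t) :
    h 0 = 0 := by
  obtain ⟨C, hC⟩ := hbdd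
  by_contra hne
  have hpos : 0 < ‖h 0‖ := norm_pos_iff.mpr hne
  obtain ⟨δ, hδ, hδh⟩ := Metric.continuousOn_iff.mp hh 0 (by simp) (‖h 0‖ / 2) (by positivity)
  have hm : 0 < min δ 1 / 2 := by positivity
  set a := Real.log (min δ 1 / 2) with ha
  have hexp : ∀ s ∈ Iic a, Real.exp s ≤ min δ 1 / 2 := by
    intro s hs
    rw [← Real.exp_log hm]
    exact Real.exp_le_exp.mpr hs
  have hmem : ∀ s ∈ Iic a, Real.exp s ∈ Ioc (0 : ℝ) 1 := by
    intro s hs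
    refine ⟨Real.exp_pos s, ?_⟩
    have := hexp s hs
    have := min_le_right δ 1
    linarith
  have hder : ∀ s ∈ Iic a, HasDerivWithinAt (fun s => Y (Real.exp s) + s • h 0)
      (h 0 - h (Real.exp s)) (Iic a) s := by
    intro s hs
    have h1 := HasDerivWithinAt.scomp (h := Real.exp) s (hY _ (hmem s hs))
      (Real.hasDerivAt_exp s).hasDerivWithinAt (s := Iic a) hmem
    have h2 := ((hasDerivWithinAt_id s (Iic a)).smul_const (h 0))
    have h3 := h1.add h2
    refine h3.congr_deriv ?_
    rw [smul_neg, smul_smul, mul_one_div_cancel (Real.exp_pos s).ne', one_smul, one_smul]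
    abel
  have hbd : ∀ s ∈ Iic a, ‖h 0 - h (Real.exp s)‖ ≤ ‖h 0‖ / 2 := by
    intro s hs
    have h1 := hmem s hs
    have h2 := hexp s hs
    have h3 := min_le_left δ 1
    have := hδh (Real.exp s) ⟨h1.1.le, h1.2⟩ (by
      rw [Real.dist_eq, sub_zero, abs_of_pos h1.1]; linarith)
    rw [dist_comm, dist_eq_norm] at this
    exact this.le
  have hC0 : 0 ≤ C := (norm_nonneg _).trans (hC 1 (by simp))
  set L := (4 * C + 1) / ‖h 0‖ with hL
  have hL0 : 0 ≤ L := by positivity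
  have hLh : L * ‖h 0‖ = 4 * C + 1 := by rw [hL]; field_simp
  have has : a - L ∈ Iic a := by simp [hL0]
  have haa : a ∈ Iic a := by simp
  have key := (convex_Iic a).norm_image_sub_le_of_norm_hasDerivWithin_le hder hbd has haa
  have e1 : ‖a - (a - L)‖ = L := by rw [sub_sub_cancel, Real.norm_of_nonneg hL0]
  rw [e1] at key
  have e2 : L • h 0 = ((Y (Real.exp a) + a • h 0) - (Y (Real.exp (a - L)) + (a - L) • h 0))
      - Y (Real.exp a) + Y (Real.exp (a - L)) := by
    rw [sub_smul]; abel
  have e3 : ‖L • h 0‖ = 4 * C + 1 := by rw [norm_smul, Real.norm_of_nonneg hL0, hLh]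
  have k1 := hC _ (hmem a haa)
  have k2 := hC _ (hmem _ has)
  rw [e2] at e3
  have k3 := norm_add_le ((Y (Real.exp a) + a • h 0) - (Y (Real.exp (a - L)) + (a - L) • h 0)
      - Y (Real.exp a)) (Y (Real.exp (a - L)))
  have k4 := norm_sub_le ((Y (Real.exp a) + a • h 0) - (Y (Real.exp (a - L)) + (a - L) • h 0))
      (Y (Real.exp a))
  nlinarith
end

section
/- Let n ≥ 1, ε > 0, let f : ℝ × ℝⁿ → ℝⁿ be continuously differentiable, and let Y₀ ∈ ℝⁿ with f(0, Y₀) = 0. Define f̂ : ℝ × ℝⁿ → ℝⁿ by f̂(ξ, v) := v + ∫₀¹ [∂f/∂ξ (tξ, Y₀ + tξ·v) + (∂f/∂Y)(tξ, Y₀ + tξ·v)·v] dt, where ∂f/∂ξ is the partial derivative in the first (scalar) variable and ∂f/∂Y is the partial Fréchet derivative in the second variable. Let Y : (0, ε) → ℝⁿ be differentiable and set Ŷ(ξ) := (Y(ξ) − Y₀)/ξ. Then Y satisfies Y'(ξ) + (1/ξ)·f(ξ, Y(ξ)) = 0 for all ξ ∈ (0, ε) if and only if Ŷ satisfies Ŷ'(ξ)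 + (1/ξ)·f̂(ξ, Ŷ(ξ)) = 0 for all ξ ∈ (0, ε). -/
open Set Filter

theorem aux_integrand {n : ℕ} (f : ℝ × (Fin n → ℝ) → (Fin n → ℝ))
    (hf : ContDiff ℝ 1 f) (a : ℝ) (w v : Fin n → ℝ) :
    deriv (fun s : ℝ => f (s, w)) a + (fderiv ℝ (fun w : Fin n → ℝ => f (a, w)) w) v
      = fderiv ℝ f (a, w) (1, v) := by
  have hd : HasFDerivAt f (fderiv ℝ f (a, w)) (a, w) :=
    (hf.differentiable one_ne_zero (a, w)).hasFDerivAt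
  have h1 : HasDerivAt (fun s : ℝ => f (s, w)) (fderiv ℝ f (a, w) (1, 0)) a :=
    hd.comp_hasDerivAt a ((hasDerivAt_id a).prodMk (hasDerivAt_const a w))
  have h2 : HasFDerivAt (fun w : Fin n → ℝ => f (a, w)) _ w :=
    hd.comp w (hasFDerivAt_prodMk_right a w)
  rw [h1.deriv, h2.fderiv]
  simp [← map_add]

theorem aux_ftc {n : ℕ} (f : ℝ × (Fin n → ℝ) → (Fin n → ℝ))
    (hf : ContDiff ℝ 1 f) (Y₀ : Fin n → ℝ) (hY₀ : f (0, Y₀) = 0) (ξ : ℝ) (v : Fin n → ℝ) :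
    ξ • (∫ t in (0:ℝ)..1, fderiv ℝ f (t * ξ, Y₀ + (t * ξ) • v) (1, v))
      = f (ξ, Y₀ + ξ • v) := by
  have hc : Continuous (fun t : ℝ => ξ • fderiv ℝ f (t * ξ, Y₀ + (t * ξ) • v) (1, v)) := by
    have := hf.continuous_fderiv one_ne_zero
    fun_prop
  have hg : ∀ t : ℝ, HasDerivAt (fun t : ℝ => f (t * ξ, Y₀ + (t * ξ) • v))
      (ξ • fderiv ℝ f (t * ξ, Y₀ + (t * ξ) • v) (1, v)) t := by
    intro t
    have hd : HasFDerivAt f _ (t * ξ, Y₀ + (t * ξ) • v) :=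
      (hf.differentiable one_ne_zero _).hasFDerivAt
    have h0 : HasDerivAt (fun t : ℝ => t * ξ) ξ t := by
      simpa using (hasDerivAt_id t).mul_const ξ
    have h := hd.comp_hasDerivAt t (h0.prodMk ((h0.smul_const v).const_add Y₀))
    have e : ξ • ((1 : ℝ), v) = (ξ, ξ • v) := by simp
    rw [← map_smul, e]
    exact h
  have := intervalIntegral.integral_eq_sub_of_hasDerivAt (fun t _ => hg t)
    (hc.intervalIntegrable 0 1)
  rw [← intervalIntegral.integral_smul, this]
  simp [hY₀]

theorem normalization_of_regular_singular_system
    (n : ℕ) (hn : 1 ≤ n) (ε : ℝ) (hε : 0 < ε)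
    (f : ℝ × (Fin n → ℝ) → (Fin n → ℝ))
    (hf : ContDiff ℝ 1 f)
    (Y₀ : Fin n → ℝ) (hY₀ : f (0, Y₀) = 0)
    (fhat : ℝ → (Fin n → ℝ) → (Fin n → ℝ))
    (hfhat : ∀ (ξ : ℝ) (v : Fin n → ℝ), fhat ξ v = v +
      ∫ t in (0:ℝ)..1,
        (deriv (fun s : ℝ => f (s, Y₀ + (t * ξ) • v)) (t * ξ) +
          (fderiv ℝ (fun w : Fin n → ℝ => f (t * ξ, w)) (Y₀ + (t * ξ) • v)) v))
    (Y : ℝ → (Fin n → ℝ))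
    (hYdiff : ∀ ξ ∈ Set.Ioo (0 : ℝ) ε, DifferentiableAt ℝ Y ξ)
    (Yhat : ℝ → (Fin n → ℝ))
    (hYhat : ∀ ξ : ℝ, Yhat ξ = (1 / ξ) • (Y ξ - Y₀)) :
    (∀ ξ ∈ Set.Ioo (0 : ℝ) ε, deriv Y ξ + (1 / ξ) • f (ξ, Y ξ) = 0) ↔
      (∀ ξ ∈ Set.Ioo (0 : ℝ) ε, deriv Yhat ξ + (1 / ξ) • fhat ξ (Yhat ξ) = 0) := by
  refine forall₂_congr fun ξ hξ => ?_
  have hξ0 : ξ ≠ 0 := hξ.1.ne'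
  have hY : Y ξ = Y₀ + ξ • Yhat ξ := by
    rw [hYhat, smul_smul, mul_one_div_cancel hξ0]; simp
  have hF : f (ξ, Y ξ) = ξ • (fhat ξ (Yhat ξ) - Yhat ξ) := by
    rw [hfhat, add_sub_cancel_left, hY, ← aux_ftc f hf Y₀ hY₀]
    simp only [aux_integrand f hf]
  have hD : DifferentiableAt ℝ Yhat ξ := by
    have : Yhat = fun ξ : ℝ => (1 / ξ) • (Y ξ - Y₀) := funext hYhat
    rw [this]
    exact ((differentiableAt_const _).div differentiableAt_id hξ0).smul
      ((hYdiff ξ hξ).sub_const Y₀)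
  have hY' : deriv Y ξ = ξ • deriv Yhat ξ + Yhat ξ := by
    have h1 : HasDerivAt (fun x : ℝ => Y₀ + x • Yhat x) (ξ • deriv Yhat ξ + (1:ℝ) • Yhat ξ) ξ :=
      ((hasDerivAt_id ξ).smul hD.hasDerivAt).const_add Y₀
    have h2 : Y =ᶠ[nhds ξ] (fun x : ℝ => Y₀ + x • Yhat x) := by
      filter_upwards [isOpen_ne.mem_nhds hξ0] with x hx
      rw [hYhat, smul_smul, mul_one_div_cancel hx]; simp
    rw [h2.deriv_eq, h1.deriv, one_smul]
  have key : deriv Y ξ + (1 / ξ) • f (ξ, Y ξ)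
      = ξ • (deriv Yhat ξ + (1 / ξ) • fhat ξ (Yhat ξ)) := by
    rw [hF, hY', smul_smul, one_div_mul_cancel hξ0, smul_add, smul_smul,
      mul_one_div_cancel hξ0]
    simp only [one_smul]
    abel
  rw [key, smul_eq_zero]
  simp [hξ0]
end

section
/- Let n ≥ 1, ε > 0, let f : ℝ × ℝⁿ → ℝⁿ be continuously differentiable, and let Y : (0, ε) → ℝⁿ be differentiable with Y'(ξ) + (1/ξ)·f(ξ, Y(ξ)) = 0 for all ξ ∈ (0, ε). Assume that Y₀ := lim_{ξ→0⁺} Y(ξ) exists, and that Y₁ := lim_{ξ→0⁺} (Y(ξ) − Y₀)/ξ exists (i.e. Y is differentiable at ξ = 0 from the right with derivative Y₁). Then: (i) f(0, Y₀) = 0; and (ii) a₀ + (Id + A₀)·Y₁ = 0, where a₀ := ∂f/∂ξ (0, Y₀) is the partial derivative of f in the first variable at (0, Y₀) and A₀ := ∂f/∂Y (0, Y₀) is the partial Fréchet derivative of f in the second variable at (0, Y₀). -/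
open Set Filter

lemma slope_iff_aux {E : Type*} [NormedAddCommGroup E] [NormedSpace ℝ E] (h : ℝ → E) (d : E) :
    HasDerivWithinAt h d (Ioi 0) 0 ↔
      Tendsto (fun ξ : ℝ => (1 / ξ) • (h ξ - h 0)) (nhdsWithin 0 (Ioi (0 : ℝ))) (nhds d) := by
  rw [hasDerivWithinAt_iff_tendsto_slope' (by simp)]
  have : slope h 0 = fun ξ : ℝ => (1 / ξ) • (h ξ - h 0) := by
    funext ξ
    simp [slope_def_module]
  rw [this]

lemma deriv_limit_aux {E : Type*} [NormedAddCommGroup E] [NormedSpace ℝ E] (ε : ℝ) (hε : 0 < ε)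
    (h h' : ℝ → E) (d e : E)
    (hd : ∀ ξ ∈ Ioo (0 : ℝ) ε, HasDerivAt h (h' ξ) ξ)
    (he : Tendsto h' (nhdsWithin 0 (Ioi (0 : ℝ))) (nhds e))
    (hs : HasDerivWithinAt h d (Ioi 0) 0) : e = d := by
  have hmem : Ioo (0 : ℝ) ε ∈ nhdsWithin 0 (Ioi (0 : ℝ)) := Ioo_mem_nhdsGT hε
  have h1 : HasDerivWithinAt h e (Ici 0) 0 := by
    refine hasDerivWithinAt_Ici_of_tendsto_deriv (s := Ioo 0 ε)
      (fun x hx => (hd x hx).differentiableAt.differentiableWithinAt)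
      (hs.continuousWithinAt.mono Ioo_subset_Ioi_self) hmem ?_
    refine he.congr' ?_
    filter_upwards [hmem] with x hx
    exact (hd x hx).deriv.symm
  exact (uniqueDiffWithinAt_Ioi (0 : ℝ)).eq_deriv _ (h1.mono Ioi_subset_Ici_self) hs

theorem compatibility_conditions_at_singular_point
    (n : ℕ) (hn : 1 ≤ n) (ε : ℝ) (hε : 0 < ε)
    (f : ℝ × (Fin n → ℝ) → (Fin n → ℝ))
    (hf : ContDiff ℝ 1 f)
    (Y : ℝ → (Fin n → ℝ))
    (hY : ∀ ξ ∈ Set.Ioo (0 : ℝ) ε, HasDerivAt Y (-((1 / ξ) • f (ξ, Y ξ))) ξ)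
    (Y₀ Y₁ : Fin n → ℝ)
    (hY₀ : Filter.Tendsto Y (nhdsWithin 0 (Set.Ioi (0 : ℝ))) (nhds Y₀))
    (hY₁ : Filter.Tendsto (fun ξ : ℝ => (1 / ξ) • (Y ξ - Y₀))
      (nhdsWithin 0 (Set.Ioi (0 : ℝ))) (nhds Y₁)) :
    f (0, Y₀) = 0 ∧
    deriv (fun s : ℝ => f (s, Y₀)) 0 +
      (Y₁ + (fderiv ℝ (fun w : Fin n → ℝ => f (0, w)) Y₀) Y₁) = 0 := by
  have hmem : Ioo (0 : ℝ) ε ∈ nhdsWithin 0 (Ioi (0 : ℝ)) := Ioo_mem_nhdsGT hε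
  -- extend `Y` to `0` by its limit
  obtain ⟨Z, hZ0, hZ⟩ : ∃ Z : ℝ → (Fin n → ℝ), Z 0 = Y₀ ∧ ∀ ξ, ξ ≠ 0 → Z ξ = Y ξ :=
    ⟨Function.update Y 0 Y₀, by simp, fun ξ h => by simp [h]⟩
  have hne : ∀ᶠ ξ in nhdsWithin 0 (Ioi (0 : ℝ)), Z ξ = Y ξ := by
    filter_upwards [self_mem_nhdsWithin] with ξ hξ
    exact hZ ξ (ne_of_gt hξ)
  have hZd : ∀ ξ ∈ Ioo (0 : ℝ) ε, HasDerivAt Z (-((1 / ξ) • f (ξ, Z ξ))) ξ := by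
    intro ξ hξ
    rw [hZ ξ hξ.1.ne']
    refine (hY ξ hξ).congr_of_eventuallyEq ?_
    filter_upwards [isOpen_ne.mem_nhds hξ.1.ne'] with x hx
    exact hZ x hx
  have hZl : Tendsto Z (nhdsWithin 0 (Ioi (0 : ℝ))) (nhds Y₀) :=
    hY₀.congr' (hne.mono fun ξ h => h.symm)
  have hZ1 : HasDerivWithinAt Z Y₁ (Ioi 0) 0 := by
    rw [slope_iff_aux]
    refine hY₁.congr' (hne.mono fun ξ h => ?_)
    simp only [h, hZ0]
  have hid : Tendsto (fun ξ : ℝ => ξ) (nhdsWithin 0 (Ioi (0 : ℝ))) (nhds 0) :=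
    tendsto_id.mono_left nhdsWithin_le_nhds
  have hg : Tendsto (fun ξ : ℝ => f (ξ, Z ξ)) (nhdsWithin 0 (Ioi (0 : ℝ))) (nhds (f (0, Y₀))) :=
    (hf.continuous.tendsto (0, Y₀)).comp (hid.prodMk_nhds hZl)
  have hi : f (0, Y₀) = 0 := by
    have key := deriv_limit_aux ε hε (fun ξ => ξ • Z ξ) (fun ξ => Z ξ - f (ξ, Z ξ)) Y₀
      (Y₀ - f (0, Y₀)) ?_ (hZl.sub hg) ?_
    · simpa using key
    · intro ξ hξ
      have := (hasDerivAt_id ξ).smul (hZd ξ hξ)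
      refine this.congr_deriv ?_
      have h0 : ξ ≠ 0 := hξ.1.ne'
      simp [smul_smul, h0]
      abel
    · have := (hasDerivWithinAt_id (0 : ℝ) (Ioi 0)).smul hZ1
      refine this.congr_deriv ?_
      simp [hZ0]
  refine ⟨hi, ?_⟩
  have hF : HasFDerivAt f (fderiv ℝ f (0, Y₀)) (0, Y₀) :=
    (hf.differentiable (by simp) (0, Y₀)).hasFDerivAt
  set L := fderiv ℝ f (0, Y₀) with hL
  have ha : deriv (fun s : ℝ => f (s, Y₀)) 0 = L (1, 0) :=
    (hF.comp_hasDerivAt (0 : ℝ) ((hasDerivAt_id (0 : ℝ)).prodMk (hasDerivAt_const (0 : ℝ) Y₀))).deriv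
  have hA : fderiv ℝ (fun w : Fin n → ℝ => f (0, w)) Y₀ Y₁ = L (0, Y₁) := by
    have := (hF.comp Y₀ ((hasFDerivAt_const (0 : ℝ) Y₀).prodMk (hasFDerivAt_id Y₀))).fderiv
    have h2 : fderiv ℝ (fun w : Fin n → ℝ => f (0, w)) Y₀ = _ := this
    rw [h2]
    simp
  have hgd : HasDerivWithinAt (fun ξ : ℝ => f (ξ, Z ξ)) (L (1, Y₁)) (Ioi 0) 0 := by
    have hF' : HasFDerivAt f L (0, Z 0) := by rw [hZ0]; exact hF
    exact hF'.comp_hasDerivWithinAt (0 : ℝ) ((hasDerivWithinAt_id (0 : ℝ) (Ioi 0)).prodMk hZ1)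
  rw [slope_iff_aux] at hgd
  simp only [hZ0, hi, sub_zero] at hgd
  have key := deriv_limit_aux ε hε Z _ Y₁ _ hZd hgd.neg hZ1
  have hsum : L (1, Y₁) = L (1, 0) + L (0, Y₁) := by
    rw [← map_add]; simp
  rw [ha, hA]
  rw [hsum] at key
  linear_combination -key
end

section
/- Define y : (0, ∞) → ℝ by y(t) := exp(−1/t) and g : [0, ∞) → ℝ by g(u) := u·log(1/u) for u > 0 and g(0) := 0. Then: (i) y'(t) = (1/t²)·y(t) for all t > 0; (ii) t·y'(t) = g(y(t)) for all t > 0, i.e. y solves the regular-singular equation y' = (1/t)·g(y); and (iii) g is continuous on [0, ∞) but g is not differentiable at 0. In particular, there is a regular-singular equation with merely continuous (non-differentiable) right-hand side whose solution has an essential singularity exp(−1/t) at the singular point. -/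
open Set Filter Real

theorem regularity_counterexample
    (y : ℝ → ℝ) (hy : ∀ t : ℝ, y t = Real.exp (-1 / t))
    (g : ℝ → ℝ)
    (hg : ∀ u : ℝ, 0 < u → g u = u * Real.log (1 / u))
    (hg0 : g 0 = 0) :
    (∀ t ∈ Set.Ioi (0 : ℝ), HasDerivAt y ((1 / t ^ 2) * y t) t) ∧
    (∀ t ∈ Set.Ioi (0 : ℝ), t * deriv y t = g (y t)) ∧
    ContinuousOn g (Set.Ici (0 : ℝ)) ∧
    ¬ DifferentiableWithinAt ℝ g (Set.Ici (0 : ℝ)) 0 := by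
  have h1 : ∀ t ∈ Set.Ioi (0 : ℝ), HasDerivAt y ((1 / t ^ 2) * y t) t := by
    intro t ht
    have ht' : t ≠ 0 := ne_of_gt ht
    have hfun : y = fun t => Real.exp (-t⁻¹) := by
      funext s
      rw [hy, neg_div, one_div]
    rw [hfun]
    have h := ((hasDerivAt_inv ht').fun_neg).exp
    convert h using 1
    field_simp
  refine ⟨h1, ?_, ?_, ?_⟩
  · intro t ht
    have ht' : t ≠ 0 := ne_of_gt ht
    have hpos : 0 < y t := by rw [hy]; exact Real.exp_pos _
    rw [(h1 t ht).deriv, hg _ hpos, one_div (y t), Real.log_inv]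
    have : Real.log (y t) = -1 / t := by rw [hy, Real.log_exp]
    rw [this]
    field_simp
  · refine Real.continuous_negMulLog.continuousOn.congr ?_
    intro u hu
    rcases eq_or_lt_of_le (show (0 : ℝ) ≤ u from hu) with h | h
    · rw [← h, hg0, Real.negMulLog_zero]
    · rw [hg u h, one_div, Real.log_inv, Real.negMulLog]
      ring
  · intro hd
    have h := hasDerivWithinAt_iff_tendsto_slope.1 hd.hasDerivWithinAt
    rw [Set.Ici_sdiff_left] at h
    have hlog : Tendsto (fun u : ℝ => -Real.log u) (nhdsWithin 0 (Set.Ioi 0)) atTop :=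
      tendsto_neg_atBot_atTop.comp Real.tendsto_log_nhdsGT_zero
    refine not_tendsto_nhds_of_tendsto_atTop (hlog.congr' ?_) _ h
    filter_upwards [self_mem_nhdsWithin] with u hu
    have hu' : u ≠ 0 := ne_of_gt hu
    rw [slope_def_field, hg u hu, hg0, one_div, Real.log_inv]
    field_simp
    ring
end
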